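/- Let g ∈ S₀(ℝ) with g ≠ 0 and let Λ ⊆ ℝ² be a lattice such that (g, Λ) is a frame for its closed linear span 𝒢 = 𝒢(g, Λ). Then exactly one of the following holds: (a) there exists m ∈ ℕ, m ≥ 1, such that 𝔍(𝒢) ⊆ (1/m)Λ; (b) 𝒢 = L²(ℝ). -/

import Mathlib

open MeasureTheory Complex Filter
open scoped ENNReal InnerProductSpace RealInnerProductSpace ComplexConjugate

noncomputable section

/-- The Hilbert space `L²(ℝ)` of complex-valued square-integrable functions. -/
abbrev L2 : Type := Lp ℂ 2 (volume : Measure ℝ)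

lemma memLp_translate (a : ℝ) (f : L2) :
    MemLp (fun x : ℝ => f (x - a)) 2 (volume : Measure ℝ) :=
  (Lp.memLp f).comp_measurePreserving (measurePreserving_sub_right volume a)

lemma memLp_modulate (b : ℝ) (f : L2) :
    MemLp (fun x : ℝ => Complex.exp (2 * Real.pi * Complex.I * (b * x)) * f x) 2
      (volume : Measure ℝ) := by
  refine MemLp.of_le (Lp.memLp f) ?_ ?_
  · exact (Complex.continuous_exp.comp (by fun_prop)).aestronglyMeasurable.mul
      (Lp.aestronglyMeasurable f)
  · filter_upwards with x
    have : Complex.exp (2 * Real.pi * Complex.I * (b * x))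
        = Complex.exp ((2 * Real.pi * (b * x) : ℝ) * Complex.I) := by
      push_cast; ring_nf
    rw [norm_mul, this, Complex.norm_exp_ofReal_mul_I, one_mul]

/-- Translation `T_a` on `L²(ℝ)`: `(T_a f)(x) = f (x - a)`. -/
def Tr (a : ℝ) (f : L2) : L2 := (memLp_translate a f).toLp _

/-- Modulation `M_b` on `L²(ℝ)`: `(M_b f)(x) = e^{2πibx} f x`. -/
def Mo (b : ℝ) (f : L2) : L2 := (memLp_modulate b f).toLp _

/-- Time-frequency shift `π(a,b) = T_a M_b`. -/
def tf (z : ℝ × ℝ) (f : L2) : L2 := Tr z.1 (Mo z.2 f)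

/-- The closed linear span `𝒢(g,Λ)` of the Gabor system `(g,Λ)`. -/
def gaborSpan (g : L2) (Λ : Set (ℝ × ℝ)) : Set L2 :=
  closure (Submodule.span ℂ ((fun z => tf z g) '' Λ) : Set L2)

/-- `𝔍(𝒢)`: the set of time-frequency shifts leaving `𝒢` invariant. -/
def stab (G : Set L2) : Set (ℝ × ℝ) := {z | ∀ f ∈ G, tf z f ∈ G}

/-- `Λ` is a lattice in `ℝ²` if `Λ = Aℤ²` for an invertible `2×2` matrix `A`. -/
def IsLattice (Λ : Set (ℝ × ℝ)) : Prop :=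
  ∃ A : Matrix (Fin 2) (Fin 2) ℝ, IsUnit A.det ∧
    Λ = {p : ℝ × ℝ | ∃ k l : ℤ,
      p = (A 0 0 * k + A 0 1 * l, A 1 0 * k + A 1 1 * l)}

lemma memLp_gaussian : MemLp (fun x : ℝ => (Real.exp (-Real.pi * x ^ 2) : ℂ)) 2
    (volume : Measure ℝ) := by
  rw [memLp_two_iff_integrable_sq_norm]
  · have h : Integrable (fun x : ℝ => Real.exp (-(2 * Real.pi) * x ^ 2)) volume :=
      integrable_exp_neg_mul_sq (by positivity)
    refine h.congr (Eventually.of_forall fun x => ?_)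
    simp only [Complex.norm_real, Real.norm_eq_abs, Real.abs_exp, sq, ← Real.exp_add]
    ring_nf
  · exact (Complex.continuous_ofReal.comp (by fun_prop)).aestronglyMeasurable

/-- The Gaussian `φ(x) = e^{-πx²}` as an element of `L²(ℝ)`. -/
def gaussL2 : L2 := memLp_gaussian.toLp _

/-- The Feichtinger algebra condition: `f ∈ S₀(ℝ)` iff `(a,b) ↦ ⟨f, π(a,b)φ⟩ ∈ L¹(ℝ²)`. -/
def InS0 (f : L2) : Prop :=
  Integrable (fun z : ℝ × ℝ => ⟪tf z gaussL2, f⟫_ℂ) (volume : Measure (ℝ × ℝ))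

/-- `(g,Λ)` is a frame for its closed linear span. -/
def IsFrameSeq (g : L2) (Λ : Set (ℝ × ℝ)) : Prop :=
  ∃ A B : ℝ, 0 < A ∧ 0 < B ∧ ∀ f ∈ gaborSpan g Λ,
    A * ‖f‖ ^ 2 ≤ ∑' lam : Λ, ‖⟪tf (lam : ℝ × ℝ) g, f⟫_ℂ‖ ^ 2 ∧
    ∑' lam : Λ, ‖⟪tf (lam : ℝ × ℝ) g, f⟫_ℂ‖ ^ 2 ≤ B * ‖f‖ ^ 2

/-- `(g,Λ)` is a frame for all of `L²(ℝ)`. -/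
def IsFrameL2 (g : L2) (Λ : Set (ℝ × ℝ)) : Prop :=
  ∃ A B : ℝ, 0 < A ∧ 0 < B ∧ ∀ f : L2,
    A * ‖f‖ ^ 2 ≤ ∑' lam : Λ, ‖⟪tf (lam : ℝ × ℝ) g, f⟫_ℂ‖ ^ 2 ∧
    ∑' lam : Λ, ‖⟪tf (lam : ℝ × ℝ) g, f⟫_ℂ‖ ^ 2 ≤ B * ‖f‖ ^ 2

/-- Euclidean ball of radius `ε` around `a ∈ ℝ²`. -/
def eball (ε : ℝ) (a : ℝ × ℝ) : Set (ℝ × ℝ) :=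
  {x : ℝ × ℝ | Real.sqrt ((x.1 - a.1) ^ 2 + (x.2 - a.2) ^ 2) < ε}

/-- `B_ε(Δ) = ⋃_{a ∈ Δ} B_ε(a)`. -/
def eballSet (ε : ℝ) (Δ : Set (ℝ × ℝ)) : Set (ℝ × ℝ) := ⋃ a ∈ Δ, eball ε a

/-- The separable lattice `αℤ × βℤ`. -/
def sepLattice (α β : ℝ) : Set (ℝ × ℝ) :=
  {p : ℝ × ℝ | ∃ k l : ℤ, p = (α * k, β * l)}

/-- The unimodular number `e^{2πit}`. -/
def ph (t : ℝ) : ℂ := Complex.exp (2 * Real.pi * Complex.I * t)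

lemma norm_ph (t : ℝ) : ‖ph t‖ = 1 := by
  have : ph t = Complex.exp ((2 * Real.pi * t : ℝ) * Complex.I) := by
    unfold ph; push_cast; ring_nf
  rw [this, Complex.norm_exp_ofReal_mul_I]

lemma ph_add (s t : ℝ) : ph (s + t) = ph s * ph t := by
  unfold ph; rw [← Complex.exp_add]; push_cast; ring_nf

lemma ph_zero : ph 0 = 1 := by simp [ph]

lemma conj_ph (t : ℝ) : conj (ph t) = ph (-t) := by
  unfold ph; rw [← Complex.exp_conj]; simp [Complex.conj_ofNat]

lemma continuous_ph : Continuous ph := by unfold ph; fun_prop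

lemma ph_int (n : ℤ) : ph n = 1 := by
  unfold ph
  rw [Complex.exp_eq_one_iff]
  exact ⟨n, by push_cast; ring⟩

lemma ph_eq_one_iff (t : ℝ) : ph t = 1 ↔ ∃ n : ℤ, t = n := by
  constructor
  · intro h
    obtain ⟨n, hn⟩ := Complex.exp_eq_one_iff.1 h
    refine ⟨n, ?_⟩
    have h2 : (2 * Real.pi * Complex.I : ℂ) ≠ 0 := Complex.two_pi_I_ne_zero
    have : (t : ℂ) = n := by
      apply mul_left_cancel₀ h2
      rw [hn]; ring
    exact_mod_cast this
  · rintro ⟨n, rfl⟩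
    exact ph_int n

lemma Mo_ae (b : ℝ) (f : L2) : Mo b f =ᵐ[volume] fun x => ph (b * x) * f x := by
  filter_upwards [(memLp_modulate b f).coeFn_toLp] with x hx
  unfold Mo
  rw [hx]; simp [ph]

lemma Tr_ae (a : ℝ) (f : L2) : Tr a f =ᵐ[volume] fun x => f (x - a) :=
  (memLp_translate a f).coeFn_toLp

lemma ae_sub {p : ℝ → Prop} (h : ∀ᵐ x, p x) (a : ℝ) : ∀ᵐ x : ℝ, p (x - a) :=
  (measurePreserving_sub_right volume a).quasiMeasurePreserving.ae h

lemma tf_ae (z : ℝ × ℝ) (f : L2) :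
    tf z f =ᵐ[volume] fun x => ph (z.2 * (x - z.1)) * f (x - z.1) := by
  filter_upwards [Tr_ae z.1 (Mo z.2 f), ae_sub (Mo_ae z.2 f) z.1] with x h1 h2
  unfold tf
  rw [h1, h2]

lemma tf_add (z : ℝ × ℝ) (f g : L2) : tf z (f + g) = tf z f + tf z g := by
  apply Lp.ext
  filter_upwards [tf_ae z (f + g), tf_ae z f, tf_ae z g, Lp.coeFn_add (tf z f) (tf z g),
    ae_sub (Lp.coeFn_add f g) z.1] with x h1 h2 h3 h4 h5
  rw [h1, h4, Pi.add_apply, h2, h3, h5, Pi.add_apply]; ring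

lemma tf_smul (z : ℝ × ℝ) (c : ℂ) (f : L2) : tf z (c • f) = c • tf z f := by
  apply Lp.ext
  filter_upwards [tf_ae z (c • f), tf_ae z f, Lp.coeFn_smul c (tf z f),
    ae_sub (Lp.coeFn_smul c f) z.1] with x h1 h2 h4 h5
  rw [h1, h4, Pi.smul_apply, h2, h5, Pi.smul_apply, smul_eq_mul, smul_eq_mul]; ring

lemma tf_tf (z w : ℝ × ℝ) (f : L2) : tf z (tf w f) = ph (z.2 * w.1) • tf (z + w) f := by
  apply Lp.ext
  filter_upwards [tf_ae z (tf w f), tf_ae (z + w) f, Lp.coeFn_smul (ph (z.2 * w.1)) (tf (z + w) f),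
    ae_sub (tf_ae w f) z.1] with x h1 h2 h4 h5
  rw [h1, h4, Pi.smul_apply, h2, h5, smul_eq_mul, Prod.fst_add, Prod.snd_add, ← sub_sub,
    ← mul_assoc, ← mul_assoc, ← ph_add, ← ph_add]
  congr 2; ring

lemma tf_zero (f : L2) : tf 0 f = f := by
  apply Lp.ext
  filter_upwards [tf_ae 0 f] with x h1
  rw [h1]; simp [ph_zero]

lemma norm_tf (z : ℝ × ℝ) (f : L2) : ‖tf z f‖ = ‖f‖ := by
  have h1 : eLpNorm (tf z f) 2 volume = eLpNorm f 2 volume := by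
    rw [← eLpNorm_comp_measurePreserving (Lp.aestronglyMeasurable f)
      (measurePreserving_sub_right volume z.1)]
    apply eLpNorm_congr_norm_ae
    filter_upwards [tf_ae z f] with x hx
    rw [hx, norm_mul, norm_ph, one_mul]; rfl
  rw [Lp.norm_def, Lp.norm_def, h1]

/-- The time-frequency shift as a linear isometry. -/
def tfI (z : ℝ × ℝ) : L2 →ₗᵢ[ℂ] L2 where
  toFun := tf z
  map_add' := tf_add z
  map_smul' := tf_smul z
  norm_map' := norm_tf z

lemma inner_tf_tf (z : ℝ × ℝ) (f g : L2) : ⟪tf z f, tf z g⟫_ℂ = ⟪f, g⟫_ℂ :=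
  (tfI z).inner_map_map f g

lemma tf_comm (z w : ℝ × ℝ) (f : L2) :
    tf z (tf w f) = ph (z.2 * w.1 - w.2 * z.1) • tf w (tf z f) := by
  rw [tf_tf, tf_tf, smul_smul, ← ph_add, add_comm w z]
  congr 2; ring

lemma tf_neg_tf (z : ℝ × ℝ) (f : L2) : tf (-z) (tf z f) = ph (-(z.2 * z.1)) • f := by
  rw [tf_tf, neg_add_cancel, tf_zero]; simp

lemma tf_tf_neg (z : ℝ × ℝ) (f : L2) : tf z (tf (-z) f) = ph (-(z.2 * z.1)) • f := by
  rw [tf_tf, add_neg_cancel, tf_zero]; simp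

lemma inner_tf_left (z : ℝ × ℝ) (f g : L2) :
    ⟪tf z f, g⟫_ℂ = ph (z.2 * z.1) * ⟪f, tf (-z) g⟫_ℂ := by
  rw [← inner_tf_tf z f, tf_tf_neg, inner_smul_right, ← mul_assoc, ← ph_add, add_neg_cancel,
    ph_zero, one_mul]

lemma norm_inner_tf_left (z : ℝ × ℝ) (f g : L2) :
    ‖⟪tf z f, g⟫_ℂ‖ = ‖⟪f, tf (-z) g⟫_ℂ‖ := by
  rw [inner_tf_left, norm_mul, norm_ph, one_mul]

lemma continuous_Tr (f : L2) : Continuous fun a => Tr a f := by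
  have h : ∀ a : ℝ, Tr a f = DomAddAct.mk (-a) +ᵥ f := by
    intro a
    apply Lp.ext
    filter_upwards [Tr_ae a f, DomAddAct.vadd_Lp_ae_eq (DomAddAct.mk (-a)) f] with x h1 h2
    rw [h1, h2]; simp [sub_eq_add_neg, add_comm]
  simp_rw [h]
  have hc : Continuous fun a : ℝ => DomAddAct.mk (-a) := by
    exact DomAddAct.continuous_mk.comp continuous_neg
  have : Fact ((2 : ℝ≥0∞) ≠ ∞) := ⟨by simp⟩
  exact hc.vadd continuous_const

lemma norm_Tr (a : ℝ) (f : L2) : ‖Tr a f‖ = ‖f‖ := by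
  rw [Lp.norm_def, Lp.norm_def]
  congr 1
  rw [eLpNorm_congr_ae (Tr_ae a f)]
  exact eLpNorm_comp_measurePreserving (Lp.aestronglyMeasurable f)
      (measurePreserving_sub_right volume a)

lemma Tr_sub (a : ℝ) (f g : L2) : Tr a (f - g) = Tr a f - Tr a g := by
  apply Lp.ext
  filter_upwards [Tr_ae a (f - g), Tr_ae a f, Tr_ae a g, Lp.coeFn_sub (Tr a f) (Tr a g),
    ae_sub (Lp.coeFn_sub f g) a] with x h1 h2 h3 h4 h5
  rw [h1, h4, Pi.sub_apply, h2, h3, h5, Pi.sub_apply]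

lemma continuous_Mo (f : L2) : Continuous fun b => Mo b f := by
  have key : ∀ b c : ℝ, ‖Mo b f - Mo c f‖ ^ 2 = ∫ x, ‖ph (b * x) - ph (c * x)‖ ^ 2 * ‖f x‖ ^ 2 := by
    intro b c
    have := @L2.inner_def ℝ ℂ ℂ _ _ _ _ _ (Mo b f - Mo c f) (Mo b f - Mo c f)
    rw [inner_self_eq_norm_sq_to_K] at this
    have h2 : ((‖Mo b f - Mo c f‖ ^ 2 : ℝ) : ℂ) =
      ((∫ x, ‖ph (b * x) - ph (c * x)‖ ^ 2 * ‖f x‖ ^ 2 : ℝ) : ℂ) := by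
      rw [← integral_complex_ofReal]
      push_cast
      refine Eq.trans this ?_
      apply integral_congr_ae
      filter_upwards [Mo_ae b f, Mo_ae c f, Lp.coeFn_sub (Mo b f) (Mo c f)] with x h1 h2 h3
      rw [inner_self_eq_norm_sq_to_K, h3, Pi.sub_apply, h1, h2, ← sub_mul, norm_mul]
      push_cast; rw [mul_pow]; rfl
    exact_mod_cast h2
  rw [continuous_iff_continuousAt]
  intro c
  rw [ContinuousAt, tendsto_iff_norm_sub_tendsto_zero]
  have h0 : Tendsto (fun b => ‖Mo b f - Mo c f‖ ^ 2) (nhds c) (nhds 0) := by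
    simp_rw [key]
    have hint : Integrable (fun x => 4 * ‖f x‖ ^ 2) :=
      ((memLp_two_iff_integrable_sq_norm (Lp.aestronglyMeasurable f)).1 (Lp.memLp f)).const_mul 4
    have : ContinuousAt (fun b => ∫ x, ‖ph (b * x) - ph (c * x)‖ ^ 2 * ‖f x‖ ^ 2) c := by
      apply continuousAt_of_dominated (bound := fun x => 4 * ‖f x‖ ^ 2)
      · refine Eventually.of_forall fun b => ?_
        have h1 : Continuous fun x : ℝ => ‖ph (b * x) - ph (c * x)‖ ^ 2 := by
          have := continuous_ph; fun_prop
        exact h1.aestronglyMeasurable.mul ((Lp.aestronglyMeasurable f).norm.pow 2)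
      · refine Eventually.of_forall fun b => Eventually.of_forall fun x => ?_
        rw [Real.norm_of_nonneg (by positivity)]
        gcongr
        have := norm_sub_le (ph (b * x)) (ph (c * x))
        rw [norm_ph, norm_ph] at this
        nlinarith [norm_nonneg (ph (b * x) - ph (c * x))]
      · exact hint
      · refine Eventually.of_forall fun x => ?_
        have := continuous_ph
        fun_prop
    have h := this.tendsto
    simpa using h
  have := h0.sqrt
  simpa using this

lemma continuous_tf (f : L2) : Continuous fun z => tf z f := by
  rw [continuous_iff_continuousAt]
  intro z
  have h1 : Tendsto (fun w : ℝ × ℝ => Tr w.1 (Mo z.2 f)) (nhds z) (nhds (tf z f)) :=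
    ((continuous_Tr (Mo z.2 f)).comp continuous_fst).tendsto z
  have h2 : Tendsto (fun w : ℝ × ℝ => Tr w.1 (Mo w.2 f - Mo z.2 f)) (nhds z) (nhds 0) := by
    rw [tendsto_zero_iff_norm_tendsto_zero]
    simp_rw [norm_Tr]
    have := (((continuous_Mo f).comp continuous_snd).sub
      (continuous_const (y := Mo z.2 f))).norm.tendsto z
    simpa using this
  have := h1.add h2
  rw [add_zero] at this
  refine this.congr fun w => ?_
  rw [Tr_sub, add_sub_cancel]; rfl

open scoped FourierTransform SchwartzMap ContDiff in
lemma fourier_toLp_ae {h : ℝ → ℂ} (h1 : Integrable h) (h2 : MemLp h 2) :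
    (𝓕 (h2.toLp h : L2) : L2) =ᵐ[volume] 𝓕 h := by
  have hcont : Continuous (𝓕 h) :=
    VectorFourier.fourierIntegral_continuous Real.continuous_fourierChar
      (by exact continuous_inner) h1
  apply ae_eq_of_integral_contDiff_smul_eq
  · exact (Lp.memLp _).locallyIntegrable (by norm_num)
  · exact hcont.locallyIntegrable
  · intro ψ hψ hψc
    have hψ' : ContDiff ℝ ∞ (fun x => (ψ x : ℂ)) := Complex.ofRealCLM.contDiff.comp hψ
    have hψc' : HasCompactSupport (fun x => (ψ x : ℂ)) := hψc.comp_left (g := fun x : ℝ => (x : ℂ)) (by simp)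
    let ψs : 𝓢(ℝ, ℂ) := hψc'.toSchwartzMap hψ'
    have e := congrArg (fun T : 𝓢'(ℝ, ℂ) => T ψs)
      (Lp.fourier_toTemperedDistribution_eq (h2.toLp h : L2))
    simp only [TemperedDistribution.fourier_apply, Lp.toTemperedDistribution_apply] at e
    have e2 : ∫ x, ψ x • (𝓕 (h2.toLp h : L2) : L2) x = ∫ x, ψs x • (𝓕 (h2.toLp h : L2) : L2) x := by
      rfl
    have e3 : ∫ x, ψ x • 𝓕 h x = ∫ x, ψs x • 𝓕 h x := by rfl
    rw [e2, e3, ← e]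
    have e4 := VectorFourier.integral_fourierIntegral_smul_eq_flip (L := innerₗ ℝ) (μ := volume)
      (ν := volume) (f := ψs) (g := h) Real.continuous_fourierChar
      (by exact continuous_inner) ψs.integrable h1
    rw [flip_innerₗ] at e4
    have e5 : ∫ x, ψs x • 𝓕 h x = ∫ x, 𝓕 (ψs : ℝ → ℂ) x • h x := e4.symm
    rw [e5]
    apply integral_congr_ae
    filter_upwards [h2.coeFn_toLp] with x hx
    rw [hx]; rfl

open scoped FourierTransform in
lemma lintegral_fourier {h : ℝ → ℂ} (h1 : Integrable h) (h2 : MemLp h 2) :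
    ∫⁻ ξ, ‖𝓕 h ξ‖ₑ ^ 2 = ∫⁻ x, ‖h x‖ₑ ^ 2 := by
  have a1 : eLpNorm (𝓕 h) 2 volume = eLpNorm h 2 volume := by
    rw [← eLpNorm_congr_ae (fourier_toLp_ae h1 h2), ← eLpNorm_congr_ae h2.coeFn_toLp]
    have := Lp.norm_fourier_eq (h2.toLp h : L2)
    rw [Lp.norm_def, Lp.norm_def] at this
    exact (ENNReal.toReal_eq_toReal_iff' (Lp.eLpNorm_ne_top _) (Lp.eLpNorm_ne_top _)).1 this
  have a2 : ∀ k : ℝ → ℂ, ∫⁻ x, ‖k x‖ₑ ^ 2 = eLpNorm k 2 volume ^ 2 := by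
    intro k
    have := eLpNorm_nnreal_pow_eq_lintegral (f := k) (μ := volume) (p := 2) (by norm_num)
    simpa using this.symm
  rw [a2, a2, a1]

lemma lintegral_enorm_sq (f : L2) : ∫⁻ x, ‖f x‖ₑ ^ 2 = ENNReal.ofReal (‖f‖ ^ 2) := by
  have := eLpNorm_nnreal_pow_eq_lintegral (f := f) (μ := (volume : Measure ℝ)) (p := 2) (by norm_num)
  have h2 : ∫⁻ x, ‖f x‖ₑ ^ 2 = eLpNorm f 2 volume ^ 2 := by simpa using this.symm
  rw [h2, ENNReal.ofReal_pow (norm_nonneg _), Lp.norm_def, ENNReal.ofReal_toReal (Lp.eLpNorm_ne_top _)]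

open scoped FourierTransform in
lemma inner_tf_eq_fourier (z : ℝ × ℝ) (f g : L2) :
    ⟪tf z g, f⟫_ℂ = ph (z.1 * z.2) * 𝓕 (fun x => conj (g (x - z.1)) * f x) z.2 := by
  rw [L2.inner_def, Real.fourier_real_eq_integral_exp_smul, ← integral_const_mul]
  apply integral_congr_ae
  filter_upwards [tf_ae z g] with x hx
  rw [hx, RCLike.inner_apply, map_mul, conj_ph]
  have : cexp (↑(-2 * Real.pi * x * z.2) * I) = ph (-(x * z.2)) := by
    unfold ph; push_cast; ring_nf
  rw [this, smul_eq_mul, ← mul_assoc, ← mul_assoc, ← mul_assoc, ← ph_add]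
  have : z.1 * z.2 + -(x * z.2) = -(z.2 * (x - z.1)) := by ring
  rw [this]; ring

lemma continuous_inner_tf (f g : L2) : Continuous fun z => ⟪tf z g, f⟫_ℂ :=
  (continuous_tf g).inner continuous_const

lemma lintegral_inner_tf_sq (f g : L2) :
    ∫⁻ z : ℝ × ℝ, ‖⟪tf z g, f⟫_ℂ‖ₑ ^ 2 = ENNReal.ofReal (‖f‖ ^ 2 * ‖g‖ ^ 2) := by
  have mf : Measurable f := (Lp.stronglyMeasurable f).measurable
  have mg : Measurable g := (Lp.stronglyMeasurable g).measurable
  have hswap : ∫⁻ a : ℝ, ∫⁻ x : ℝ, ‖conj (g (x - a)) * f x‖ₑ ^ 2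
      = ENNReal.ofReal (‖f‖ ^ 2 * ‖g‖ ^ 2) := by
    rw [lintegral_lintegral_swap]
    · have : ∀ x : ℝ, ∫⁻ a : ℝ, ‖conj (g (x - a)) * f x‖ₑ ^ 2
          = ENNReal.ofReal (‖g‖ ^ 2) * ‖f x‖ₑ ^ 2 := by
        intro x
        simp_rw [enorm_mul, mul_pow]
        rw [lintegral_mul_const _ (by simp only [RCLike.enorm_conj]; fun_prop)]
        congr 1
        rw [← lintegral_enorm_sq, ← lintegral_sub_left_eq_self (fun a => ‖g a‖ₑ ^ 2) x]
        simp
      simp_rw [this]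
      rw [lintegral_const_mul _ (by fun_prop), lintegral_enorm_sq,
        ← ENNReal.ofReal_mul (by positivity), mul_comm]
    · refine Measurable.aemeasurable ?_
      have := Complex.continuous_conj.measurable
      fun_prop
  rw [← hswap, Measure.volume_eq_prod, lintegral_prod _
    ((continuous_inner_tf f g).enorm.measurable.pow_const 2).aemeasurable]
  have hfin : ∀ᵐ a : ℝ, ∫⁻ x : ℝ, ‖conj (g (x - a)) * f x‖ₑ ^ 2 < ∞ := by
    apply ae_lt_top'
    · refine Measurable.aemeasurable ?_
      apply Measurable.lintegral_prod_right (f := fun a x : ℝ => ‖conj (g (x - a)) * f x‖ₑ ^ 2)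
      unfold Function.uncurry
      have := Complex.continuous_conj.measurable
      fun_prop
    · rw [hswap]; exact ENNReal.ofReal_ne_top
  apply lintegral_congr_ae
  filter_upwards [hfin] with a ha
  have hmeas : AEStronglyMeasurable (fun x => conj (g (x - a)) * f x) volume := by
    refine Measurable.aestronglyMeasurable ?_
    have := Complex.continuous_conj.measurable
    fun_prop
  have h1 : Integrable (fun x => conj (g (x - a)) * f x) volume :=
    MemLp.integrable_mul (p := 2) (q := 2) (memLp_translate a g).star (Lp.memLp f)
  have h2 : MemLp (fun x => conj (g (x - a)) * f x) 2 volume := by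
    refine ⟨hmeas, ?_⟩
    have := eLpNorm_nnreal_pow_eq_lintegral (f := fun x => conj (g (x - a)) * f x)
      (μ := (volume : Measure ℝ)) (p := 2) (by norm_num)
    have h3 : eLpNorm (fun x => conj (g (x - a)) * f x) 2 volume ^ 2 < ∞ := by
      refine lt_of_eq_of_lt ?_ ha
      simpa using this
    simpa using h3
  rw [← lintegral_fourier h1 h2]
  refine lintegral_congr fun b => ?_
  rw [inner_tf_eq_fourier, enorm_mul]
  rw [← ofReal_norm (ph _), norm_ph, ENNReal.ofReal_one, one_mul]

lemma memLp_inner_tf (f g : L2) :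
    MemLp (fun z : ℝ × ℝ => ⟪tf z g, f⟫_ℂ) 2 (volume : Measure (ℝ × ℝ)) := by
  refine ⟨(continuous_inner_tf f g).aestronglyMeasurable, ?_⟩
  have := eLpNorm_nnreal_pow_eq_lintegral (f := fun z : ℝ × ℝ => ⟪tf z g, f⟫_ℂ)
      (μ := (volume : Measure (ℝ × ℝ))) (p := 2) (by norm_num)
  have h3 : eLpNorm (fun z : ℝ × ℝ => ⟪tf z g, f⟫_ℂ) 2 volume ^ 2 < ∞ := by
    refine lt_of_eq_of_lt ?_ (lt_of_eq_of_lt (lintegral_inner_tf_sq f g) ENNReal.ofReal_lt_top)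
    simpa using this
  simpa using h3

lemma integrable_conj_mul (f₁ g₁ f₂ g₂ : L2) :
    Integrable (fun z : ℝ × ℝ => conj ⟪tf z g₂, f₂⟫_ℂ * ⟪tf z g₁, f₁⟫_ℂ) :=
  MemLp.integrable_mul (p := 2) (q := 2) (memLp_inner_tf f₂ g₂).star (memLp_inner_tf f₁ g₁)

/-- The left-hand side of Moyal's identity. -/
def moyalForm (f₁ g₁ f₂ g₂ : L2) : ℂ :=
  ∫ z : ℝ × ℝ, conj ⟪tf z g₂, f₂⟫_ℂ * ⟪tf z g₁, f₁⟫_ℂ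

lemma moyalForm_self (f g : L2) : moyalForm f g f g = ⟪f, f⟫_ℂ * ⟪g, g⟫_ℂ := by
  have h : moyalForm f g f g = ((∫ z : ℝ × ℝ, ‖⟪tf z g, f⟫_ℂ‖ ^ 2 : ℝ) : ℂ) := by
    rw [← integral_complex_ofReal]
    refine integral_congr_ae (Eventually.of_forall fun z => ?_)
    simp only
    rw [Complex.conj_mul']; push_cast; rfl
  rw [h, integral_eq_lintegral_of_nonneg_ae (Eventually.of_forall fun z => by positivity)
    (Continuous.aestronglyMeasurable (by have := continuous_inner_tf f g; fun_prop))]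
  have : ∫⁻ z : ℝ × ℝ, ENNReal.ofReal (‖⟪tf z g, f⟫_ℂ‖ ^ 2) = ENNReal.ofReal (‖f‖ ^ 2 * ‖g‖ ^ 2) := by
    rw [← lintegral_inner_tf_sq]
    refine lintegral_congr fun z => ?_
    rw [ENNReal.ofReal_pow (norm_nonneg _), ofReal_norm]
  rw [this, ENNReal.toReal_ofReal (by positivity), inner_self_eq_norm_sq_to_K,
    inner_self_eq_norm_sq_to_K]
  push_cast; rfl

lemma sesq_eq_zero {E : Type*} [AddCommGroup E] [Module ℂ E] (D : E → E → ℂ)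
    (ha : ∀ x y z, D (x + y) z = D x z + D y z) (hb : ∀ x y z, D x (y + z) = D x y + D x z)
    (hs : ∀ x z, D (Complex.I • x) z = Complex.I * D x z)
    (ht : ∀ x z, D x (Complex.I • z) = -Complex.I * D x z)
    (h0 : ∀ x, D x x = 0) (x y : E) : D x y = 0 := by
  have h1 := h0 (x + y)
  have h2 := h0 (x + Complex.I • y)
  simp only [ha, hb, hs, ht, h0, mul_zero, add_zero, zero_add] at h1 h2
  have h3 : D y x = - D x y := by linear_combination h1
  rw [h3] at h2
  have h4 : (-2 * Complex.I) * D x y = 0 := by linear_combination h2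
  simpa using h4

/-- Moyal's identity. -/
lemma moyal (f₁ g₁ f₂ g₂ : L2) : moyalForm f₁ g₁ f₂ g₂ = ⟪f₂, f₁⟫_ℂ * ⟪g₁, g₂⟫_ℂ := by
  have af : ∀ f f' g₁ f₂ g₂ : L2, moyalForm (f + f') g₁ f₂ g₂
      = moyalForm f g₁ f₂ g₂ + moyalForm f' g₁ f₂ g₂ := by
    intro f f' g₁ f₂ g₂
    unfold moyalForm
    rw [← integral_add (integrable_conj_mul _ _ _ _) (integrable_conj_mul _ _ _ _)]
    simp only [inner_add_right]; congr 1; ext z; ring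
  have ag : ∀ f g g' f₂ g₂ : L2, moyalForm f (g + g') f₂ g₂
      = moyalForm f g f₂ g₂ + moyalForm f g' f₂ g₂ := by
    intro f g g' f₂ g₂
    unfold moyalForm
    rw [← integral_add (integrable_conj_mul _ _ _ _) (integrable_conj_mul _ _ _ _)]
    simp only [tf_add, inner_add_left]; congr 1; ext z; ring
  have cj : ∀ f₁ g₁ f₂ g₂ : L2, moyalForm f₂ g₂ f₁ g₁ = conj (moyalForm f₁ g₁ f₂ g₂) := by
    intro f₁ g₁ f₂ g₂
    unfold moyalForm
    rw [← integral_conj]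
    congr 1; ext z; simp [mul_comm]
  have sf : ∀ (c : ℂ) (f g₁ f₂ g₂ : L2), moyalForm (c • f) g₁ f₂ g₂ = c * moyalForm f g₁ f₂ g₂ := by
    intro c f g₁ f₂ g₂
    unfold moyalForm
    rw [← integral_const_mul]
    simp only [inner_smul_right]; congr 1; ext z; ring
  have sg : ∀ (c : ℂ) (f g₁ f₂ g₂ : L2), moyalForm f (c • g₁) f₂ g₂
      = conj c * moyalForm f g₁ f₂ g₂ := by
    intro c f g₁ f₂ g₂
    unfold moyalForm
    rw [← integral_const_mul]
    simp only [tf_smul, inner_smul_left]; congr 1; ext z; ring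
  have af' : ∀ f f' f₁ g₁ g₂ : L2, moyalForm f₁ g₁ (f + f') g₂
      = moyalForm f₁ g₁ f g₂ + moyalForm f₁ g₁ f' g₂ := fun f f' f₁ g₁ g₂ => by
    rw [cj (f + f') g₂ f₁ g₁, af, map_add, ← cj, ← cj]
  have ag' : ∀ g g' f₁ g₁ f₂ : L2, moyalForm f₁ g₁ f₂ (g + g')
      = moyalForm f₁ g₁ f₂ g + moyalForm f₁ g₁ f₂ g' := fun g g' f₁ g₁ f₂ => by
    rw [cj f₂ (g + g') f₁ g₁, ag, map_add, ← cj, ← cj]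
  have sf' : ∀ (c : ℂ) (f f₁ g₁ g₂ : L2), moyalForm f₁ g₁ (c • f) g₂
      = conj c * moyalForm f₁ g₁ f g₂ := fun c f f₁ g₁ g₂ => by
    rw [cj (c • f) g₂ f₁ g₁, sf, map_mul, ← cj]
  have sg' : ∀ (c : ℂ) (g f₁ g₁ f₂ : L2), moyalForm f₁ g₁ f₂ (c • g)
      = c * moyalForm f₁ g₁ f₂ g := fun c g f₁ g₁ f₂ => by
    rw [cj f₂ (c • g) f₁ g₁, sg, map_mul, ← cj, Complex.conj_conj]
  have step : ∀ f₁ f₂ g : L2, moyalForm f₁ g f₂ g = ⟪f₂, f₁⟫_ℂ * ⟪g, g⟫_ℂ := by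
    intro f₁ f₂ g
    rw [← sub_eq_zero]
    refine sesq_eq_zero (fun f₁ f₂ : L2 => moyalForm f₁ g f₂ g - ⟪f₂, f₁⟫_ℂ * ⟪g, g⟫_ℂ)
      ?_ ?_ ?_ ?_ ?_ f₁ f₂
    · intro x y z; simp only [af, inner_add_right]; ring
    · intro x y z; simp only [af', inner_add_left]; ring
    · intro x z; simp only [sf, inner_smul_right]; ring
    · intro x z; simp only [sf', inner_smul_left, conj_I]; ring
    · intro x; simp [moyalForm_self]
  rw [← sub_eq_zero]
  refine sesq_eq_zero (fun g₂ g₁ : L2 => moyalForm f₁ g₁ f₂ g₂ - ⟪f₂, f₁⟫_ℂ * ⟪g₁, g₂⟫_ℂ)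
      ?_ ?_ ?_ ?_ ?_ g₂ g₁
  · intro x y z; simp only [ag', inner_add_right]; ring
  · intro x y z; simp only [ag, inner_add_left]; ring
  · intro x z; simp only [sg', inner_smul_right]; ring
  · intro x z; simp only [sg, inner_smul_left, conj_I]; ring
  · intro x; simp [step]

/-- The linear map `x ↦ A x` from coordinate vectors to points of the time-frequency plane. -/
def latVec (A : Matrix (Fin 2) (Fin 2) ℝ) (x : Fin 2 → ℝ) : ℝ × ℝ :=
  (A 0 0 * x 0 + A 0 1 * x 1, A 1 0 * x 0 + A 1 1 * x 1)

/-- The point of the adjoint lattice of `A ℤ²` with index `μ`. -/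
def adjVec (A : Matrix (Fin 2) (Fin 2) ℝ) (μ : Fin 2 → ℤ) : ℝ × ℝ :=
  ((-(A 0 1) * μ 0 + A 0 0 * μ 1) / A.det, (A 1 0 * μ 1 - A 1 1 * μ 0) / A.det)

lemma latVec_adjVec (A : Matrix (Fin 2) (Fin 2) ℝ) (hA : A.det ≠ 0) (x : Fin 2 → ℝ)
    (μ : Fin 2 → ℤ) :
    (latVec A x).2 * (adjVec A μ).1 - (adjVec A μ).2 * (latVec A x).1 = μ 0 * x 0 + μ 1 * x 1 := by
  unfold latVec adjVec
  have h : A.det = A 0 0 * A 1 1 - A 0 1 * A 1 0 := Matrix.det_fin_two A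
  have : ∀ a b c d : ℝ, a * (b / A.det) - c / A.det * d = (a * b - c * d) / A.det := by
    intro a b c d; ring
  simp only
  rw [this, div_eq_iff hA, h]
  ring

lemma exists_norm_inner_tf_gauss : ∃ C : ℝ, 0 ≤ C ∧ ∀ z : ℝ × ℝ,
    ‖⟪tf z gaussL2, gaussL2⟫_ℂ‖ = C * Real.exp (-(Real.pi / 2) * (z.1 ^ 2 + z.2 ^ 2)) := by
  refine ⟨‖((Real.pi : ℂ) / -(-2 * Real.pi : ℂ)) ^ (1 / 2 : ℂ)‖, norm_nonneg _, fun z => ?_⟩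
  have h : ⟪tf z gaussL2, gaussL2⟫_ℂ = ∫ x : ℝ, cexp ((-2 * Real.pi : ℂ) * x ^ 2
      + (2 * Real.pi * z.1 - 2 * Real.pi * I * z.2) * x
      + (-Real.pi * z.1 ^ 2 + 2 * Real.pi * I * z.1 * z.2)) := by
    rw [L2.inner_def]
    apply integral_congr_ae
    have hφ : gaussL2 =ᵐ[volume] fun x : ℝ => (Real.exp (-Real.pi * x ^ 2) : ℂ) :=
      memLp_gaussian.coeFn_toLp
    filter_upwards [tf_ae z gaussL2, hφ, ae_sub hφ z.1] with x h1 h2 h3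
    rw [h1, h2, h3, RCLike.inner_apply, map_mul, conj_ph, Complex.conj_ofReal]
    unfold ph
    push_cast
    rw [← Complex.exp_add, ← Complex.exp_add]
    congr 1
    ring
  rw [h, integral_cexp_quadratic (by simp [Real.pi_pos]), norm_mul, Complex.norm_exp]
  congr 2
  have hpi : (Real.pi : ℂ) ≠ 0 := by exact_mod_cast Real.pi_ne_zero
  have : (-(Real.pi : ℂ) * z.1 ^ 2 + 2 * Real.pi * I * z.1 * z.2)
      - (2 * Real.pi * z.1 - 2 * Real.pi * I * z.2) ^ 2 / (4 * (-2 * Real.pi))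
      = ((-(Real.pi / 2) * (z.1 ^ 2 + z.2 ^ 2) : ℝ) : ℂ) + ((Real.pi * z.1 * z.2 : ℝ) : ℂ) * I := by
    push_cast
    field_simp
    ring_nf
    rw [I_sq]; ring
  rw [this]
  simp [-ofReal_mul, -ofReal_neg]

lemma exists_tsum_exp_le (c : ℝ) (hc : 0 < c) : ∃ D : ℝ≥0∞, D ≠ ∞ ∧ ∀ x : ℝ,
    ∑' n : ℤ, ENNReal.ofReal (Real.exp (-c * (x + n) ^ 2)) ≤ D := by
  have hs : Summable fun n : ℤ => Real.exp c * Real.exp (-(c / 2) * (n : ℝ) ^ 2) := by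
    refine Summable.mul_left _ ?_
    have := summable_pow_mul_jacobiTheta₂_term_bound 0 (T := c / 2 / Real.pi) (by positivity) 0
    refine this.congr fun n => ?_
    rw [pow_zero, one_mul]
    congr 1
    field_simp
    ring
  refine ⟨∑' n : ℤ, ENNReal.ofReal (Real.exp c * Real.exp (-(c / 2) * (n : ℝ) ^ 2)),
    ?_, fun x => ?_⟩
  · rw [← ENNReal.ofReal_tsum_of_nonneg (fun n => by positivity) hs]
    exact ENNReal.ofReal_ne_top
  · rw [← (Equiv.subRight ⌊x⌋).tsum_eq]
    refine ENNReal.tsum_le_tsum fun n => ENNReal.ofReal_le_ofReal ?_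
    rw [← Real.exp_add, Real.exp_le_exp]
    have h1 : x + ((Equiv.subRight ⌊x⌋ n : ℤ) : ℝ) = Int.fract x + n := by
      simp only [Equiv.subRight_apply, Int.cast_sub, Int.fract]; ring
    rw [h1]
    have h2 := Int.fract_nonneg x
    have h3 := Int.fract_lt_one x
    set t := Int.fract x
    have h4 : (n : ℝ) ^ 2 / 2 - 1 ≤ (t + n) ^ 2 := by nlinarith [sq_nonneg (2 * t + n)]
    nlinarith

lemma exists_tsum_inner_gauss_le (A : Matrix (Fin 2) (Fin 2) ℝ) (hA : A.det ≠ 0) :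
    ∃ D : ℝ≥0∞, D ≠ ∞ ∧ ∀ y : ℝ × ℝ,
      ∑' μ : Fin 2 → ℤ, ‖⟪tf (y + adjVec A μ) gaussL2, gaussL2⟫_ℂ‖ₑ ≤ D := by
  obtain ⟨C, hC0, hC⟩ := exists_norm_inner_tf_gauss
  set R : ℝ := A 0 0 ^ 2 + A 0 1 ^ 2 + A 1 0 ^ 2 + A 1 1 ^ 2 with hR
  have hdet : A.det = A 0 0 * A 1 1 - A 0 1 * A 1 0 := Matrix.det_fin_two A
  have hRpos : 0 < R := by
    rcases eq_or_ne (A 0 0) 0 with h | h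
    · have : A 0 1 ≠ 0 := by
        rintro h'; apply hA; rw [hdet, h, h']; ring
      positivity
    · positivity
  obtain ⟨D, hD, hDle⟩ := exists_tsum_exp_le (Real.pi / 2 / R) (by positivity)
  refine ⟨ENNReal.ofReal C * (D * D), by finiteness, fun y => ?_⟩
  set l0 := A 1 0 * y.1 - A 0 0 * y.2
  set l1 := A 1 1 * y.1 - A 0 1 * y.2
  have key : ∀ μ : Fin 2 → ℤ, ‖⟪tf (y + adjVec A μ) gaussL2, gaussL2⟫_ℂ‖ₑ ≤ ENNReal.ofReal C *
      (ENNReal.ofReal (Real.exp (-(Real.pi / 2 / R) * (l0 + μ 0) ^ 2)) *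
        ENNReal.ofReal (Real.exp (-(Real.pi / 2 / R) * (l1 + μ 1) ^ 2))) := by
    intro μ
    rw [← ofReal_norm, hC, ENNReal.ofReal_mul hC0,
      ← ENNReal.ofReal_mul (Real.exp_nonneg (-(Real.pi / 2 / R) * (l0 + μ 0) ^ 2)),
      ← Real.exp_add]
    gcongr
    set v := y + adjVec A μ with hv
    have e0 : l0 + μ 0 = A 1 0 * v.1 - A 0 0 * v.2 := by
      simp only [hv, adjVec, Prod.fst_add, Prod.snd_add, l0]
      field_simp
      rw [hdet]; ring
    have e1 : l1 + μ 1 = A 1 1 * v.1 - A 0 1 * v.2 := by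
      simp only [hv, adjVec, Prod.fst_add, Prod.snd_add, l1]
      field_simp
      rw [hdet]; ring
    rw [e0, e1, ← mul_add, div_eq_mul_inv (Real.pi / 2) R]
    have : (A 1 0 * v.1 - A 0 0 * v.2) ^ 2 + (A 1 1 * v.1 - A 0 1 * v.2) ^ 2
        ≤ R * (v.1 ^ 2 + v.2 ^ 2) := by
      rw [hR]
      nlinarith [sq_nonneg (A 1 0 * v.2 + A 0 0 * v.1), sq_nonneg (A 1 1 * v.2 + A 0 1 * v.1)]
    have h2 : R⁻¹ * ((A 1 0 * v.1 - A 0 0 * v.2) ^ 2 + (A 1 1 * v.1 - A 0 1 * v.2) ^ 2)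
        ≤ v.1 ^ 2 + v.2 ^ 2 := by
      rw [inv_mul_le_iff₀ hRpos]; exact this
    nlinarith [Real.pi_pos]
  refine (ENNReal.tsum_le_tsum key).trans ?_
  rw [ENNReal.tsum_mul_left]
  gcongr
  rw [← (finTwoArrowEquiv ℤ).symm.tsum_eq, ENNReal.tsum_prod']
  simp only [finTwoArrowEquiv_symm_apply, Matrix.cons_val_zero, Matrix.cons_val_one,
    ENNReal.tsum_mul_left, ENNReal.tsum_mul_right]
  gcongr <;> exact hDle _

lemma enorm_inner_mul_le (g f φ : L2) :
    ‖⟪f, g⟫_ℂ‖ₑ * ‖⟪φ, φ⟫_ℂ‖ₑ ≤ ∫⁻ z : ℝ × ℝ, ‖⟪tf z φ, f⟫_ℂ‖ₑ * ‖⟪tf z φ, g⟫_ℂ‖ₑ := by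
  rw [← enorm_mul, ← moyal]
  refine (enorm_integral_le_lintegral_enorm _).trans (le_of_eq ?_)
  refine lintegral_congr fun z => ?_
  rw [enorm_mul]
  congr 1
  rw [← ofReal_norm, RCLike.norm_conj, ofReal_norm]

lemma enorm_inner_tf_right (z w : ℝ × ℝ) (f g : L2) :
    ‖⟪tf z f, tf w g⟫_ℂ‖ₑ = ‖⟪tf (z - w) f, g⟫_ℂ‖ₑ := by
  rw [← ofReal_norm, ← ofReal_norm]
  congr 1
  have h : tf z f = ph (-(w.2 * (z - w).1)) • tf w (tf (z - w) f) := by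
    rw [tf_tf, smul_smul, ← ph_add, neg_add_cancel, ph_zero, one_smul, add_sub_cancel]
  rw [h, inner_smul_left, norm_mul, RCLike.norm_conj, norm_ph, one_mul, inner_tf_tf]

lemma summable_norm_inner_adjVec (g : L2) (hg : InS0 g) (A : Matrix (Fin 2) (Fin 2) ℝ)
    (hA : A.det ≠ 0) : Summable fun μ : Fin 2 → ℤ => ‖⟪tf (adjVec A μ) g, g⟫_ℂ‖ := by
  obtain ⟨D, hD, hDle⟩ := exists_tsum_inner_gauss_le A hA
  set φ := gaussL2
  set c := ‖⟪φ, φ⟫_ℂ‖ₑ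
  have hc : c ≠ 0 := by
    have h1 : φ ≠ 0 := by
      intro h
      have := memLp_gaussian.coeFn_toLp.symm.trans ((show gaussL2 = 0 from h) ▸ Lp.coeFn_zero ℂ 2 volume)
      obtain ⟨x, hx⟩ := this.exists
      simp at hx
    simpa [c, enorm_eq_zero] using h1
  have hct : c ≠ ∞ := enorm_ne_top
  set V : ℝ × ℝ → ℝ≥0∞ := fun z => ‖⟪tf z φ, g⟫_ℂ‖ₑ with hV
  set K : ℝ × ℝ → ℝ≥0∞ := fun z => ‖⟪tf z φ, φ⟫_ℂ‖ₑ with hK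
  have mV : Measurable V := (continuous_inner_tf g φ).enorm.measurable
  have mK : Measurable K := (continuous_inner_tf φ φ).enorm.measurable
  have hVint : ∫⁻ z, V z ≠ ∞ := hg.hasFiniteIntegral.ne
  have h1 : ∀ z, V z * c ≤ ∫⁻ z', V z' * K (z' - z) := by
    intro z
    refine (enorm_inner_mul_le g (tf z φ) φ).trans (le_of_eq ?_)
    refine lintegral_congr fun z' => ?_
    rw [enorm_inner_tf_right, mul_comm]
  have h2 : ∀ w, ‖⟪tf w g, g⟫_ℂ‖ₑ * c ≤ ∫⁻ z, V (z - w) * V z := by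
    intro w
    refine (enorm_inner_mul_le g (tf w g) φ).trans (le_of_eq ?_)
    refine lintegral_congr fun z => ?_
    rw [enorm_inner_tf_right]
  have h3 : ∀ w, ‖⟪tf w g, g⟫_ℂ‖ₑ * c * c ≤ ∫⁻ z, ∫⁻ z', V z * V z' * K (z' - z + w) := by
    intro w
    calc ‖⟪tf w g, g⟫_ℂ‖ₑ * c * c ≤ (∫⁻ z, V (z - w) * V z) * c := by gcongr; exact h2 w
      _ = ∫⁻ z, V (z - w) * V z * c := by
        rw [lintegral_mul_const]
        exact (mV.comp (measurable_id.sub_const w)).mul mV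
      _ ≤ ∫⁻ z, ∫⁻ z', V z * V z' * K (z' - z + w) := by
        refine lintegral_mono fun z => ?_
        calc V (z - w) * V z * c = V z * (V (z - w) * c) := by ring
          _ ≤ V z * ∫⁻ z', V z' * K (z' - (z - w)) := by gcongr; exact h1 _
          _ = ∫⁻ z', V z * V z' * K (z' - z + w) := by
            rw [← lintegral_const_mul]
            · refine lintegral_congr fun z' => ?_
              rw [mul_assoc, sub_sub_eq_add_sub, sub_add_eq_add_sub]
            · exact mV.mul (mK.comp (measurable_id.sub_const _))
  have h4 : (∑' μ : Fin 2 → ℤ, ‖⟪tf (adjVec A μ) g, g⟫_ℂ‖ₑ) * c * c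
      ≤ (∫⁻ z, V z) * (∫⁻ z, V z) * D := by
    rw [← ENNReal.tsum_mul_right, ← ENNReal.tsum_mul_right]
    refine (ENNReal.tsum_le_tsum fun μ => h3 _).trans ?_
    have m2 : ∀ w, Measurable (Function.uncurry fun z z' => V z * V z' * K (z' - z + w)) := by
      intro w
      refine ((mV.comp measurable_fst).mul (mV.comp measurable_snd)).mul (mK.comp ?_)
      exact (measurable_snd.sub measurable_fst).add_const w
    rw [← lintegral_tsum fun μ => (Measurable.lintegral_prod_right (m2 _)).aemeasurable]
    calc ∫⁻ z, ∑' μ, ∫⁻ z', V z * V z' * K (z' - z + adjVec A μ)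
        ≤ ∫⁻ z, ∫⁻ z', V z * V z' * D := by
          refine lintegral_mono fun z => ?_
          rw [← lintegral_tsum fun μ =>
            ((m2 (adjVec A μ)).comp (measurable_prodMk_left (x := z))).aemeasurable (f := fun z' =>
              V z * V z' * K (z' - z + adjVec A μ))]
          refine lintegral_mono fun z' => ?_
          rw [ENNReal.tsum_mul_left]
          gcongr
          exact hDle _
      _ = (∫⁻ z, V z) * (∫⁻ z, V z) * D := by
          have : ∀ z, ∫⁻ z', V z * V z' * D = V z * ((∫⁻ z, V z) * D) := by
            intro z
            rw [lintegral_mul_const _ (mV.const_mul _), lintegral_const_mul _ mV, mul_assoc]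
          simp_rw [this]
          rw [lintegral_mul_const _ mV, mul_assoc]
  have h5 : (∑' μ : Fin 2 → ℤ, ‖⟪tf (adjVec A μ) g, g⟫_ℂ‖ₑ) ≠ ∞ := by
    intro h
    rw [h, ENNReal.top_mul hc, ENNReal.top_mul hc, top_le_iff] at h4
    exact (show (∫⁻ z, V z) * (∫⁻ z, V z) * D ≠ ∞ by finiteness) h4
  have h6 := ENNReal.summable_toReal h5
  simpa using h6

/-- An integer vector viewed in `ℝ²`. -/
def castVec (k : Fin 2 → ℤ) : Fin 2 → ℝ := fun i => k i

/-- The pairing of an integer vector with a real vector. -/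
def idot (μ : Fin 2 → ℤ) (x : Fin 2 → ℝ) : ℝ := μ 0 * x 0 + μ 1 * x 1

lemma idot_add (μ : Fin 2 → ℤ) (x y : Fin 2 → ℝ) : idot μ (x + y) = idot μ x + idot μ y := by
  simp only [idot, Pi.add_apply]; ring

lemma idot_castVec (μ k : Fin 2 → ℤ) : idot μ (castVec k) = ((μ 0 * k 0 + μ 1 * k 1 : ℤ) : ℝ) := by
  simp [idot, castVec]

lemma continuous_idot (μ : Fin 2 → ℤ) : Continuous (idot μ) := by unfold idot; fun_prop

lemma ph_idot_add_castVec (μ : Fin 2 → ℤ) (x : Fin 2 → ℝ) (k : Fin 2 → ℤ) :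
    ph (idot μ (x + castVec k)) = ph (idot μ x) := by
  rw [idot_add, ph_add, idot_castVec, ph_int, mul_one]

/-- The projection of the plane onto the torus. -/
def torusMk (x : Fin 2 → ℝ) : UnitAddTorus (Fin 2) := fun i => (x i : UnitAddCircle)

lemma isOpenQuotientMap_torusMk : IsOpenQuotientMap torusMk :=
  IsOpenQuotientMap.piMap fun _ => QuotientAddGroup.isOpenQuotientMap_mk

lemma torusMk_eq_iff (x y : Fin 2 → ℝ) : torusMk x = torusMk y ↔ ∃ k, y = x + castVec k := by
  constructor
  · intro h
    have h1 : ∀ i, ∃ n : ℤ, y i = x i + n := by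
      intro i
      have h2 : ((x i : ℝ) : UnitAddCircle) = ((y i : ℝ) : UnitAddCircle) := congrFun h i
      rw [← sub_eq_zero, ← AddCircle.coe_sub, AddCircle.coe_eq_zero_iff] at h2
      obtain ⟨n, hn⟩ := h2
      exact ⟨-n, by simp at hn; push_cast; linarith⟩
    choose k hk using h1
    exact ⟨k, funext hk⟩
  · rintro ⟨k, rfl⟩
    funext i
    simp [torusMk, castVec]

lemma mFourier_torusMk (μ : Fin 2 → ℤ) (x : Fin 2 → ℝ) :
    UnitAddTorus.mFourier μ (torusMk x) = ph (idot μ x) := by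
  simp only [UnitAddTorus.mFourier, torusMk, ContinuousMap.coe_mk, Fin.prod_univ_two,
    fourier_coe_apply]
  rw [← Complex.exp_add, ph, idot]
  push_cast
  ring_nf

/-- The half-open unit square. -/
def unitSquare : Set (Fin 2 → ℝ) := {x | ∀ i, x i ∈ Set.Ioc (0 : ℝ) (0 + 1)}

lemma hasSum_fourier_of_periodic (F : (Fin 2 → ℝ) → ℂ) (hF : Continuous F)
    (hper : ∀ x k, F (x + castVec k) = F x) (c : (Fin 2 → ℤ) → ℂ) (hc : Summable c)
    (hcoef : ∀ μ, ∫ x in unitSquare, ph (-(idot μ x)) * F x = c μ) (x : Fin 2 → ℝ) :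
    HasSum (fun μ => c μ * ph (idot μ x)) (F x) := by
  have hq := isOpenQuotientMap_torusMk
  have hfac : Function.FactorsThrough F torusMk := by
    intro a b hab
    obtain ⟨k, rfl⟩ := (torusMk_eq_iff a b).1 hab
    rw [hper]
  let F' : C(UnitAddTorus (Fin 2), ℂ) :=
    Topology.IsQuotientMap.lift (f := ⟨torusMk, hq.continuous⟩) hq.isQuotientMap ⟨F, hF⟩ hfac
  have hF' : ∀ y, F' (torusMk y) = F y := fun y => by
    have := Topology.IsQuotientMap.lift_comp (f := ⟨torusMk, hq.continuous⟩) hq.isQuotientMap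
      ⟨F, hF⟩ hfac
    exact congrArg (fun G : C(Fin 2 → ℝ, ℂ) => G y) this
  have hcoef' : UnitAddTorus.mFourierCoeff F' = c := by
    funext μ
    rw [UnitAddTorus.mFourierCoeff_eq_integral F' μ 0, ← hcoef]
    congr 1
    funext y
    change UnitAddTorus.mFourier (-μ) (torusMk y) • F' (torusMk y) = _
    rw [mFourier_torusMk, hF', smul_eq_mul]
    congr 2
    simp [idot]; ring
  have h := UnitAddTorus.hasSum_mFourier_series_apply_of_summable (f := F') (by rwa [hcoef'])
    (torusMk x)
  simpa only [hcoef', hF', mFourier_torusMk, smul_eq_mul] using h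

lemma integral_unitSquare_tsum (H : (Fin 2 → ℝ) → ℂ) (hH : Integrable H) :
    ∫ x in unitSquare, ∑' k, H (x + castVec k) = ∫ x, H x := by
  let s : (Fin 2 → ℤ) → Set (Fin 2 → ℝ) := fun k => {x | ∀ i, ⌈x i⌉ = k i + 1}
  have hs : ∀ k, MeasurableSet (s k) := by
    intro k
    have : s k = ⋂ i, (fun x : Fin 2 → ℝ => ⌈x i⌉) ⁻¹' {k i + 1} := by ext x; simp [s]
    rw [this]
    exact MeasurableSet.iInter fun i =>
      (Int.measurable_ceil.comp (measurable_pi_apply i)) (measurableSet_singleton _)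
  have hd : Pairwise (Function.onFun Disjoint s) := by
    intro k l hkl
    refine Set.disjoint_left.2 fun x hx hy => hkl (funext fun i => ?_)
    have h1 := hx i
    have h2 := hy i
    omega
  have hu : ⋃ k, s k = Set.univ := by
    refine Set.eq_univ_of_forall fun x => Set.mem_iUnion.2 ⟨fun i => ⌈x i⌉ - 1, fun i => ?_⟩
    simp
  have hpre : ∀ k, (fun x => x + castVec k) ⁻¹' s k = unitSquare := by
    intro k
    ext x
    simp only [s, Set.mem_preimage, Set.mem_ofPred_eq, castVec, Pi.add_apply, unitSquare,
      Set.mem_Ioc, Int.ceil_add_intCast]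
    refine forall_congr' fun i => ?_
    rw [add_comm (k i) 1, add_left_inj, Int.ceil_eq_iff]
    simp
  have hshift : ∀ (E : (Fin 2 → ℝ) → ℂ) k,
      ∫ x in s k, E x = ∫ x in unitSquare, E (x + castVec k) := by
    intro E k
    rw [← hpre k]
    exact ((measurePreserving_add_right volume (castVec k)).setIntegral_preimage_emb
      (MeasurableEquiv.addRight (castVec k)).measurableEmbedding E (s k)).symm
  have hshift' : ∀ (E : (Fin 2 → ℝ) → ℝ) k,
      ∫ x in s k, E x = ∫ x in unitSquare, E (x + castVec k) := by
    intro E k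
    rw [← hpre k]
    exact ((measurePreserving_add_right volume (castVec k)).setIntegral_preimage_emb
      (MeasurableEquiv.addRight (castVec k)).measurableEmbedding E (s k)).symm
  have h1 := hasSum_integral_iUnion hs hd (by rw [hu]; exact hH.integrableOn)
  have h2 := hasSum_integral_iUnion hs hd (by rw [hu]; exact hH.norm.integrableOn)
  simp only [hshift, hu, Measure.restrict_univ] at h1
  simp only [hshift'] at h2
  have h3 := hasSum_integral_of_summable_integral_norm
    (F := fun k x => H (x + castVec k)) (μ := volume.restrict unitSquare)
    (fun k => (hH.comp_add_right (castVec k)).integrableOn) h2.summable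
  exact h3.unique h1

lemma latVec_eq (A : Matrix (Fin 2) (Fin 2) ℝ) :
    latVec A = MeasurableEquiv.finTwoArrow ∘ Matrix.toLin' A := by
  funext x
  simp [latVec, MeasurableEquiv.finTwoArrow, Matrix.mulVec, dotProduct, Fin.sum_univ_two]

lemma continuous_latVec (A : Matrix (Fin 2) (Fin 2) ℝ) : Continuous (latVec A) := by
  unfold latVec; fun_prop

lemma latVec_add (A : Matrix (Fin 2) (Fin 2) ℝ) (x y : Fin 2 → ℝ) :
    latVec A (x + y) = latVec A x + latVec A y := by
  simp only [latVec, Pi.add_apply, Prod.mk_add_mk]; congr 1 <;> ring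

lemma map_latVec (A : Matrix (Fin 2) (Fin 2) ℝ) (hA : A.det ≠ 0) :
    Measure.map (latVec A) volume = ENNReal.ofReal |A.det⁻¹| • volume := by
  rw [latVec_eq, ← Measure.map_map (MeasurableEquiv.measurable _)
    (LinearMap.continuous_of_finiteDimensional _).measurable,
    Real.map_matrix_volume_pi_eq_smul_volume_pi hA, Measure.map_smul,
    (volume_preserving_finTwoArrow ℝ).map_eq]

lemma integral_comp_latVec (A : Matrix (Fin 2) (Fin 2) ℝ) (hA : A.det ≠ 0) (Ψ : ℝ × ℝ → ℂ)
    (hΨ : Continuous Ψ) : ∫ x, Ψ (latVec A x) = |A.det⁻¹| * ∫ z, Ψ z := by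
  rw [← integral_map (continuous_latVec A).aemeasurable hΨ.aestronglyMeasurable, map_latVec A hA,
    integral_smul_measure, ENNReal.toReal_ofReal (abs_nonneg _), Complex.real_smul]

lemma integrable_comp_latVec (A : Matrix (Fin 2) (Fin 2) ℝ) (hA : A.det ≠ 0) (Ψ : ℝ × ℝ → ℂ)
    (hΨ : Integrable Ψ) : Integrable fun x => Ψ (latVec A x) := by
  have h : Integrable Ψ (Measure.map (latVec A) volume) := by
    rw [map_latVec A hA]; exact hΨ.smul_measure ENNReal.ofReal_ne_top
  exact h.comp_aemeasurable (continuous_latVec A).aemeasurable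

lemma continuous_tsum_of_bessel {ι : Type*} (e : ι → L2) (B : ℝ)
    (hs : ∀ f, Summable fun i => ‖⟪e i, f⟫_ℂ‖ ^ 2)
    (hB : ∀ f, ∑' i, ‖⟪e i, f⟫_ℂ‖ ^ 2 ≤ B * ‖f‖ ^ 2) :
    Continuous fun f => ∑' i, ‖⟪e i, f⟫_ℂ‖ ^ 2 := by
  have h2 : (2 : ℝ≥0∞).toReal = 2 := by norm_num
  let C : L2 →ₗ[ℂ] lp (fun _ : ι => ℂ) 2 :=
    { toFun := fun f => ⟨fun i => ⟪e i, f⟫_ℂ, memℓp_gen (by simpa [h2] using hs f)⟩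
      map_add' := fun f g => by
        ext i; exact inner_add_right _ _ _
      map_smul' := fun c f => by
        ext i; simp [inner_smul_right] }
  have hC : ∀ f, ‖C f‖ ^ 2 = ∑' i, ‖⟪e i, f⟫_ℂ‖ ^ 2 := by
    intro f
    have := lp.norm_rpow_eq_tsum (p := 2) (by norm_num) (C f)
    simpa [h2, C] using this
  have hC' : Continuous C := by
    refine (C.mkContinuous (√B) fun f => ?_).continuous
    refine le_of_sq_le_sq ?_ (by positivity)
    rcases le_or_gt 0 B with h | h
    · rw [hC, mul_pow, Real.sq_sqrt h]; exact hB f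
    · have h3 := (hC f).trans_le (hB f)
      nlinarith [sq_nonneg ‖C f‖, sq_nonneg ‖f‖, sq_nonneg (√B * ‖f‖)]
  simp_rw [← hC]
  exact hC'.norm.pow 2

/-- The periodized spectrogram of `f` with window `g`. -/
def perSpec (A : Matrix (Fin 2) (Fin 2) ℝ) (g f : L2) (x : Fin 2 → ℝ) : ℝ :=
  ∑' k : Fin 2 → ℤ, ‖⟪tf (latVec A (x + castVec k)) g, f⟫_ℂ‖ ^ 2

/-- The Bessel condition for the Gabor system generated by `g` over `A ℤ²`. -/
def IsBessel (A : Matrix (Fin 2) (Fin 2) ℝ) (g : L2) : Prop :=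
  ∃ B : ℝ, ∀ f, Summable (fun k : Fin 2 → ℤ => ‖⟪tf (latVec A (castVec k)) g, f⟫_ℂ‖ ^ 2) ∧
    ∑' k : Fin 2 → ℤ, ‖⟪tf (latVec A (castVec k)) g, f⟫_ℂ‖ ^ 2 ≤ B * ‖f‖ ^ 2

lemma norm_inner_tf_add (z w : ℝ × ℝ) (g f : L2) :
    ‖⟪tf (z + w) g, f⟫_ℂ‖ = ‖⟪tf w g, tf (-z) f⟫_ℂ‖ := by
  have h : tf (z + w) g = ph (-(z.2 * w.1)) • tf z (tf w g) := by
    rw [tf_tf, smul_smul, ← ph_add, neg_add_cancel, ph_zero, one_smul]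
  rw [h, inner_smul_left, norm_mul, RCLike.norm_conj, norm_ph, one_mul, norm_inner_tf_left]

lemma perSpec_eq (A : Matrix (Fin 2) (Fin 2) ℝ) (g f : L2) (x : Fin 2 → ℝ) :
    perSpec A g f x
      = ∑' k : Fin 2 → ℤ, ‖⟪tf (latVec A (castVec k)) g, tf (-latVec A x) f⟫_ℂ‖ ^ 2 := by
  unfold perSpec
  simp_rw [latVec_add, norm_inner_tf_add]

lemma continuous_perSpec (A : Matrix (Fin 2) (Fin 2) ℝ) (g f : L2) (hb : IsBessel A g) :
    Continuous (perSpec A g f) := by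
  obtain ⟨B, hB⟩ := hb
  have h := continuous_tsum_of_bessel (fun k : Fin 2 → ℤ => tf (latVec A (castVec k)) g) B
    (fun f => (hB f).1) (fun f => (hB f).2)
  have h2 : perSpec A g f = (fun f => ∑' k : Fin 2 → ℤ, ‖⟪tf (latVec A (castVec k)) g, f⟫_ℂ‖ ^ 2) ∘
      fun x => tf (-latVec A x) f := funext fun x => perSpec_eq A g f x
  rw [h2]
  exact h.comp ((continuous_tf f).comp (continuous_latVec A).neg)

lemma castVec_add (k l : Fin 2 → ℤ) : castVec (k + l) = castVec k + castVec l := by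
  funext i; simp [castVec]

lemma perSpec_add_castVec (A : Matrix (Fin 2) (Fin 2) ℝ) (g f : L2) (x : Fin 2 → ℝ)
    (k : Fin 2 → ℤ) : perSpec A g f (x + castVec k) = perSpec A g f x := by
  unfold perSpec
  rw [← (Equiv.addLeft k).tsum_eq (fun l => ‖⟪tf (latVec A (x + castVec l)) g, f⟫_ℂ‖ ^ 2)]
  simp only [Equiv.coe_addLeft, castVec_add, add_assoc]

/-- The symplectic twist of the spectrogram. -/
lemma conj_inner_mul_inner_tf (z w : ℝ × ℝ) (g f : L2) :
    conj ⟪tf z g, f⟫_ℂ * ⟪tf z (tf w g), tf w f⟫_ℂ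
      = ph (-(z.2 * w.1 - w.2 * z.1)) * (‖⟪tf z g, f⟫_ℂ‖ ^ 2 : ℝ) := by
  rw [tf_comm z w g, inner_smul_left, conj_ph, inner_tf_tf, mul_left_comm, Complex.conj_mul']
  push_cast; rfl

lemma integral_unitSquare_perSpec (A : Matrix (Fin 2) (Fin 2) ℝ) (hA : A.det ≠ 0) (g f : L2)
    (μ : Fin 2 → ℤ) :
    ∫ x in unitSquare, ph (-(idot μ x)) * (perSpec A g f x : ℂ)
      = |A.det⁻¹| * (⟪tf (adjVec A μ) g, g⟫_ℂ * ⟪f, tf (adjVec A μ) f⟫_ℂ) := by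
  set w := adjVec A μ
  set Ψ : ℝ × ℝ → ℂ := fun z => conj ⟪tf z g, f⟫_ℂ * ⟪tf z (tf w g), tf w f⟫_ℂ with hΨdef
  have hΨ : ∀ x, Ψ (latVec A x)
      = ph (-(idot μ x)) * (‖⟪tf (latVec A x) g, f⟫_ℂ‖ ^ 2 : ℝ) := by
    intro x
    rw [hΨdef]
    simp only
    rw [conj_inner_mul_inner_tf, latVec_adjVec A hA, idot]
  have hint : Integrable Ψ := integrable_conj_mul _ _ _ _
  have hcont : Continuous Ψ := by
    exact (continuous_star.comp (continuous_inner_tf f g)).mul (continuous_inner_tf _ _)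
  have h1 := integral_unitSquare_tsum _ (integrable_comp_latVec A hA Ψ hint)
  rw [integral_comp_latVec A hA Ψ hcont] at h1
  have h2 : ∫ z, Ψ z = ⟪tf w g, g⟫_ℂ * ⟪f, tf w f⟫_ℂ := by
    rw [mul_comm]; exact moyal (tf w f) (tf w g) f g
  rw [← h2, ← h1]
  congr 1
  funext x
  simp_rw [hΨ, ← conj_ph, ph_idot_add_castVec]
  rw [tsum_mul_left]
  congr 1
  rw [perSpec, Complex.ofReal_tsum]

lemma hasSum_perSpec (A : Matrix (Fin 2) (Fin 2) ℝ) (hA : A.det ≠ 0) (g f : L2)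
    (hg : Summable fun μ : Fin 2 → ℤ => ‖⟪tf (adjVec A μ) g, g⟫_ℂ‖) (hb : IsBessel A g)
    (x : Fin 2 → ℝ) :
    HasSum (fun μ => |A.det⁻¹| * (⟪tf (adjVec A μ) g, g⟫_ℂ * ⟪f, tf (adjVec A μ) f⟫_ℂ)
      * ph (idot μ x)) (perSpec A g f x : ℂ) := by
  refine hasSum_fourier_of_periodic (fun x => (perSpec A g f x : ℂ)) ?_ ?_ _ ?_ ?_ x
  · exact Complex.continuous_ofReal.comp (continuous_perSpec A g f hb)
  · intro x k; simp only [perSpec_add_castVec]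
  · refine Summable.mul_left _ (Summable.of_norm_bounded (hg.mul_right (‖f‖ * ‖f‖)) fun μ => ?_)
    rw [norm_mul]
    gcongr
    exact (norm_inner_le_norm _ _).trans (by rw [norm_tf])
  · exact integral_unitSquare_perSpec A hA g f

/-- The absolutely convergent combination `∑ c μ π(w_μ)` of adjoint-lattice shifts. -/
def adjOp (A : Matrix (Fin 2) (Fin 2) ℝ) (c : (Fin 2 → ℤ) → ℂ) : L2 →L[ℂ] L2 :=
  ∑' μ, c μ • (tfI (adjVec A μ)).toContinuousLinearMap

lemma norm_smul_tfI_le (c : ℂ) (z : ℝ × ℝ) : ‖c • (tfI z).toContinuousLinearMap‖ ≤ ‖c‖ := by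
  rw [norm_smul]
  exact mul_le_of_le_one_right (norm_nonneg _) (LinearIsometry.norm_toContinuousLinearMap_le _)

lemma hasSum_inner_adjOp (A : Matrix (Fin 2) (Fin 2) ℝ) (c : (Fin 2 → ℤ) → ℂ)
    (hc : Summable fun μ => ‖c μ‖) (f f' : L2) :
    HasSum (fun μ => c μ * ⟪f, tf (adjVec A μ) f'⟫_ℂ) ⟪f, adjOp A c f'⟫_ℂ := by
  have h : HasSum (fun μ => c μ • (tfI (adjVec A μ)).toContinuousLinearMap) (adjOp A c) :=
    (Summable.of_norm_bounded hc fun μ => norm_smul_tfI_le _ _).hasSum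
  have h2 := (h.mapL (ContinuousLinearMap.apply ℂ L2 f')).mapL (innerSL ℂ f)
  have h3 : (fun μ => c μ * ⟪f, tf (adjVec A μ) f'⟫_ℂ) = fun μ => innerSL ℂ f
      (ContinuousLinearMap.apply ℂ L2 f' (c μ • (tfI (adjVec A μ)).toContinuousLinearMap)) :=
    funext fun μ => (inner_smul_right f (tf (adjVec A μ) f') (c μ)).symm
  rw [h3]
  exact h2

/-- The coefficients of the frame-type operator in the adjoint-lattice representation. -/
def adjCoef (A : Matrix (Fin 2) (Fin 2) ℝ) (g : L2) (μ : Fin 2 → ℤ) : ℂ :=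
  |A.det⁻¹| * ⟪tf (adjVec A μ) g, g⟫_ℂ

lemma summable_norm_adjCoef (A : Matrix (Fin 2) (Fin 2) ℝ) (g : L2)
    (hg : Summable fun μ : Fin 2 → ℤ => ‖⟪tf (adjVec A μ) g, g⟫_ℂ‖) :
    Summable fun μ => ‖adjCoef A g μ‖ := by
  simp only [adjCoef, norm_mul]
  exact hg.mul_left _

/-- The operator whose quadratic form is the periodized spectrogram at `x`. -/
def specOp (A : Matrix (Fin 2) (Fin 2) ℝ) (g : L2) (x : Fin 2 → ℝ) : L2 →L[ℂ] L2 :=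
  adjOp A fun μ => adjCoef A g μ * ph (idot μ x)

lemma inner_specOp_self (A : Matrix (Fin 2) (Fin 2) ℝ) (hA : A.det ≠ 0) (g f : L2)
    (hg : Summable fun μ : Fin 2 → ℤ => ‖⟪tf (adjVec A μ) g, g⟫_ℂ‖) (hb : IsBessel A g)
    (x : Fin 2 → ℝ) : ⟪f, specOp A g x f⟫_ℂ = perSpec A g f x := by
  have h1 := hasSum_inner_adjOp A (fun μ => adjCoef A g μ * ph (idot μ x))
    (by simpa only [norm_mul, norm_ph, mul_one] using summable_norm_adjCoef A g hg) f f
  refine h1.unique ?_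
  convert hasSum_perSpec A hA g f hg hb x using 2 with μ
  rw [adjCoef]; ring

/-- Functions whose short-time Fourier transform vanishes on the translate `A (x + ℤ²)`. -/
def NullAt (A : Matrix (Fin 2) (Fin 2) ℝ) (g : L2) (x : Fin 2 → ℝ) (f : L2) : Prop :=
  ∀ k, ⟪tf (latVec A (x + castVec k)) g, f⟫_ℂ = 0

lemma nullAt_add_iff (A : Matrix (Fin 2) (Fin 2) ℝ) (g : L2) (x y : Fin 2 → ℝ) (f : L2) :
    NullAt A g (x + y) f ↔ NullAt A g y (tf (-latVec A x) f) := by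
  unfold NullAt
  refine forall_congr' fun k => ?_
  rw [← norm_eq_zero, add_assoc, latVec_add, norm_inner_tf_add, norm_eq_zero]

lemma inner_eq_zero_of_quadratic_form (S : L2 →L[ℂ] L2) (f : L2) (hf : ⟪f, S f⟫_ℂ = 0)
    (h : ∀ (f' : L2) (c : ℂ), ⟪f' + c • f, S (f' + c • f)⟫_ℂ = ⟪f', S f'⟫_ℂ) (f' : L2) :
    ⟪f', S f⟫_ℂ = 0 ∧ ⟪f, S f'⟫_ℂ = 0 := by
  have h1 := h f' 1
  have h2 := h f' I
  simp only [map_add, map_smul, inner_add_left, inner_add_right, inner_smul_left,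
    inner_smul_right, hf, conj_I, map_one] at h1 h2
  have e1 : ⟪f', S f⟫_ℂ + ⟪f, S f'⟫_ℂ = 0 := by linear_combination h1
  have e2 : I * (⟪f', S f⟫_ℂ - ⟪f, S f'⟫_ℂ) = 0 := by linear_combination h2
  have e3 : ⟪f', S f⟫_ℂ - ⟪f, S f'⟫_ℂ = 0 := (mul_eq_zero.1 e2).resolve_left I_ne_zero
  exact ⟨by linear_combination (e1 + e3) / 2, by linear_combination (e1 - e3) / 2⟩

lemma inner_specOp_of_nullAt (A : Matrix (Fin 2) (Fin 2) ℝ) (hA : A.det ≠ 0) (g f f' : L2)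
    (hg : Summable fun μ : Fin 2 → ℤ => ‖⟪tf (adjVec A μ) g, g⟫_ℂ‖) (hb : IsBessel A g)
    (x : Fin 2 → ℝ) (hf : NullAt A g x f) :
    ⟪f', specOp A g x f⟫_ℂ = 0 ∧ ⟪f, specOp A g x f'⟫_ℂ = 0 := by
  refine inner_eq_zero_of_quadratic_form _ f ?_ (fun h c => ?_) f'
  · rw [inner_specOp_self A hA g f hg hb, perSpec]
    have hf' : ∀ k, ⟪tf (latVec A (x + castVec k)) g, f⟫_ℂ = 0 := hf
    simp [hf']
  · simp only [inner_specOp_self A hA g _ hg hb, perSpec]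
    have hf' : ∀ k, ⟪tf (latVec A (x + castVec k)) g, f⟫_ℂ = 0 := hf
    simp [inner_add_right, inner_smul_right, hf']

open Classical in
/-- The average of `specOp A g (x + n u)` over `n`. -/
def meanOp (A : Matrix (Fin 2) (Fin 2) ℝ) (g : L2) (u x : Fin 2 → ℝ) : L2 →L[ℂ] L2 :=
  adjOp A fun μ => if ph (idot μ u) = 1 then adjCoef A g μ * ph (idot μ x) else 0

open Classical in
lemma tendsto_mean_ph (t : ℝ) :
    Tendsto (fun N : ℕ => (N : ℂ)⁻¹ * ∑ n ∈ Finset.range N, ph (n * t)) atTop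
      (nhds (if ph t = 1 then 1 else 0)) := by
  have hpow : ∀ n : ℕ, ph (n * t) = ph t ^ n := by
    intro n
    unfold ph
    rw [← Complex.exp_nat_mul]
    congr 1; push_cast; ring
  simp_rw [hpow]
  split_ifs with h
  · refine tendsto_const_nhds.congr' ?_
    filter_upwards [eventually_ne_atTop 0] with N hN
    simp [h, hN]
  · simp_rw [geom_sum_eq h]
    rw [tendsto_zero_iff_norm_tendsto_zero]
    have h0 : Tendsto (fun N : ℕ => (N : ℝ)⁻¹ * (2 / ‖ph t - 1‖)) atTop (nhds 0) := by
      simpa using (tendsto_inv_atTop_nhds_zero_nat (𝕜 := ℝ)).mul_const (2 / ‖ph t - 1‖)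
    refine squeeze_zero (fun _ => norm_nonneg _) (fun N => ?_) h0
    rw [norm_mul, norm_div, norm_inv, Complex.norm_natCast]
    gcongr
    refine (norm_sub_le _ _).trans ?_
    rw [norm_pow, norm_ph, one_pow, norm_one]; norm_num

open Classical in
lemma tendsto_mean_specOp (A : Matrix (Fin 2) (Fin 2) ℝ) (g f f' : L2)
    (hg : Summable fun μ : Fin 2 → ℤ => ‖⟪tf (adjVec A μ) g, g⟫_ℂ‖) (u x : Fin 2 → ℝ) :
    Tendsto (fun N : ℕ => (N : ℂ)⁻¹ * ∑ n ∈ Finset.range N, ⟪f', specOp A g (x + (n : ℝ) • u) f⟫_ℂ)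
      atTop (nhds ⟪f', meanOp A g u x f⟫_ℂ) := by
  have hs := summable_norm_adjCoef A g hg
  have h1 : ∀ y, HasSum (fun μ => adjCoef A g μ * ph (idot μ y) * ⟪f', tf (adjVec A μ) f⟫_ℂ)
      ⟪f', specOp A g y f⟫_ℂ := fun y =>
    hasSum_inner_adjOp A _ (by simpa only [norm_mul, norm_ph, mul_one] using hs) f' f
  have h2 := hasSum_inner_adjOp A
    (fun μ => if ph (idot μ u) = 1 then adjCoef A g μ * ph (idot μ x) else 0)
    (by
      refine Summable.of_nonneg_of_le (fun _ => norm_nonneg _) (fun μ => ?_) hs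
      split_ifs
      · rw [norm_mul, norm_ph, mul_one]
      · simp) f' f
  have h3 : ∀ N : ℕ, (N : ℂ)⁻¹ * ∑ n ∈ Finset.range N, ⟪f', specOp A g (x + (n : ℝ) • u) f⟫_ℂ
      = ∑' μ, adjCoef A g μ * ph (idot μ x) * ⟪f', tf (adjVec A μ) f⟫_ℂ *
        ((N : ℂ)⁻¹ * ∑ n ∈ Finset.range N, ph (n * idot μ u)) := by
    intro N
    rw [← ((hasSum_sum fun n (_ : n ∈ Finset.range N) => h1 (x + (n : ℝ) • u)).mul_left
      (N : ℂ)⁻¹).tsum_eq]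
    refine tsum_congr fun μ => ?_
    have : ∀ n : ℕ, idot μ (x + (n : ℝ) • u) = idot μ x + n * idot μ u := by
      intro n; simp [idot]; ring
    simp_rw [this, ph_add, Finset.mul_sum]
    refine Finset.sum_congr rfl fun n _ => by ring
  simp_rw [h3]
  change Tendsto _ _ (nhds ⟪f', adjOp A _ f⟫_ℂ)
  rw [← h2.tsum_eq]
  refine tendsto_tsum_of_dominated_convergence (bound := fun μ => ‖adjCoef A g μ‖ * (‖f'‖ * ‖f‖))
    (hs.mul_right _) (fun μ => ?_) (Eventually.of_forall fun N μ => ?_)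
  · have := (tendsto_mean_ph (idot μ u)).const_mul
      (adjCoef A g μ * ph (idot μ x) * ⟪f', tf (adjVec A μ) f⟫_ℂ)
    convert this using 2
    split_ifs <;> simp
  · rw [norm_mul, norm_mul, norm_mul, norm_ph, mul_one]
    refine (mul_le_of_le_one_right (by positivity) ?_).trans ?_
    · rw [norm_mul, norm_inv, Complex.norm_natCast]
      have : ‖∑ n ∈ Finset.range N, ph (n * idot μ u)‖ ≤ N := by
        refine (norm_sum_le _ _).trans ?_
        simp [norm_ph]
      rcases Nat.eq_zero_or_pos N with rfl | hN
      · simp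
      · rw [inv_mul_le_iff₀ (by positivity), mul_one]; exact this
    · gcongr
      exact (norm_inner_le_norm _ _).trans (by rw [norm_tf])

lemma continuous_meanOp (A : Matrix (Fin 2) (Fin 2) ℝ) (g : L2)
    (hg : Summable fun μ : Fin 2 → ℤ => ‖⟪tf (adjVec A μ) g, g⟫_ℂ‖) (u : Fin 2 → ℝ) :
    Continuous (meanOp A g u) := by
  classical
  unfold meanOp adjOp
  refine continuous_tsum (fun μ => ?_) (summable_norm_adjCoef A g hg) (fun μ x => ?_)
  · dsimp only
    split_ifs
    · exact (continuous_const.mul (continuous_ph.comp (continuous_idot μ))).smul continuous_const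
    · exact continuous_const
  · refine (norm_smul_tfI_le _ _).trans ?_
    dsimp only
    split_ifs
    · rw [norm_mul, norm_ph, mul_one]
    · simp

lemma collinear_of_irrational (u : Fin 2 → ℝ)
    (hu : ∀ m : ℕ, 1 ≤ m → ∀ k, (m : ℝ) • u ≠ castVec k) (μ ν : Fin 2 → ℤ)
    (hμ : ph (idot μ u) = 1) (hν : ph (idot ν u) = 1) : μ 0 * ν 1 - μ 1 * ν 0 = 0 := by
  by_contra hD
  obtain ⟨p, hp⟩ := (ph_eq_one_iff _).1 hμ
  obtain ⟨r, hr⟩ := (ph_eq_one_iff _).1 hν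
  set D := μ 0 * ν 1 - μ 1 * ν 0 with hDdef
  unfold idot at hp hr
  have hDr : (D : ℝ) = μ 0 * ν 1 - μ 1 * ν 0 := by rw [hDdef]; push_cast; ring
  have e0 : (D : ℝ) * u 0 = ((p * ν 1 - r * μ 1 : ℤ) : ℝ) := by
    push_cast; rw [← hp, ← hr, hDr]; ring
  have e1 : (D : ℝ) * u 1 = ((μ 0 * r - ν 0 * p : ℤ) : ℝ) := by
    push_cast; rw [← hp, ← hr, hDr]; ring
  have habs : ((D.natAbs : ℕ) : ℝ) = D.sign * D := by
    rw [← Int.cast_mul, Int.sign_mul_self_eq_natAbs]; simp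
  refine hu D.natAbs (Int.natAbs_pos.2 hD)
    ![D.sign * (p * ν 1 - r * μ 1), D.sign * (μ 0 * r - ν 0 * p)] ?_
  funext i
  fin_cases i
  · simp only [Fin.zero_eta, Pi.smul_apply, smul_eq_mul, habs, castVec, Matrix.cons_val_zero,
      mul_assoc, e0]
    push_cast; ring
  · simp only [Fin.mk_one, Pi.smul_apply, smul_eq_mul, habs, castVec, Matrix.cons_val_one,
      mul_assoc, e1]
    push_cast; ring

lemma tf_adjVec_comm (A : Matrix (Fin 2) (Fin 2) ℝ) (μ ν : Fin 2 → ℤ)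
    (h : μ 0 * ν 1 - μ 1 * ν 0 = 0) (f : L2) :
    tf (adjVec A μ) (tf (adjVec A ν) f) = tf (adjVec A ν) (tf (adjVec A μ) f) := by
  have h' : (μ 0 * ν 1 - μ 1 * ν 0 : ℝ) = 0 := by exact_mod_cast h
  rw [tf_comm]
  have : (adjVec A μ).2 * (adjVec A ν).1 - (adjVec A ν).2 * (adjVec A μ).1 = 0 := by
    unfold adjVec
    have : ∀ a b c d D : ℝ, a / D * (b / D) - c / D * (d / D) = (a * b - c * d) / (D * D) := by
      intro a b c d D
      rw [div_mul_div_comm, div_mul_div_comm, sub_div]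
    simp only
    rw [this]
    refine div_eq_zero_iff.2 (Or.inl ?_)
    linear_combination (A 0 1 * A 1 0 - A 0 0 * A 1 1) * h'
  rw [this, ph_zero, one_smul]

lemma commute_meanOp (A : Matrix (Fin 2) (Fin 2) ℝ) (g : L2) (u x y : Fin 2 → ℝ)
    (hu : ∀ m : ℕ, 1 ≤ m → ∀ k, (m : ℝ) • u ≠ castVec k) :
    Commute (meanOp A g u x) (meanOp A g u y) := by
  classical
  refine Commute.tsum_left _ fun μ => Commute.tsum_right _ fun ν => ?_
  dsimp only
  split_ifs with h1 h2
  · refine (Commute.smul_right ?_ _).smul_left _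
    refine ContinuousLinearMap.ext fun f => ?_
    exact tf_adjVec_comm A μ ν (collinear_of_irrational u hu μ ν h1 h2) f
  all_goals simp

lemma latVec_smul (A : Matrix (Fin 2) (Fin 2) ℝ) (c : ℝ) (x : Fin 2 → ℝ) :
    latVec A (c • x) = c • latVec A x := by
  simp only [latVec, Pi.smul_apply, smul_eq_mul, Prod.smul_mk]; congr 1 <;> ring

lemma tf_add_mem {G : Submodule ℂ L2} {z w : ℝ × ℝ} (hz : ∀ q ∈ G, tf z q ∈ G)
    (hw : ∀ q ∈ G, tf w q ∈ G) : ∀ q ∈ G, tf (z + w) q ∈ G := by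
  intro q hq
  have h : tf (z + w) q = ph (-(z.2 * w.1)) • tf z (tf w q) := by
    rw [tf_tf, smul_smul, ← ph_add, neg_add_cancel, ph_zero, one_smul]
  rw [h]
  exact G.smul_mem _ (hz _ (hw q hq))

lemma tf_nsmul_mem {G : Submodule ℂ L2} {z : ℝ × ℝ} (hz : ∀ q ∈ G, tf z q ∈ G) (n : ℕ) :
    ∀ q ∈ G, tf ((n : ℝ) • z) q ∈ G := by
  induction n with
  | zero => intro q hq; simpa [tf_zero] using hq
  | succ n ih =>
    have : ((n + 1 : ℕ) : ℝ) • z = (n : ℝ) • z + z := by push_cast; rw [add_smul, one_smul]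
    rw [this]
    exact tf_add_mem ih hz

lemma tf_neg_mem_orthogonal {G : Submodule ℂ L2} {z : ℝ × ℝ} (hz : ∀ q ∈ G, tf z q ∈ G)
    {f : L2} (hf : f ∈ Gᗮ) : tf (-z) f ∈ Gᗮ := by
  rw [Submodule.mem_orthogonal] at hf ⊢
  intro q hq
  rw [← norm_eq_zero, ← norm_inner_tf_left, norm_eq_zero]
  exact hf _ (hz q hq)

lemma nullAt_iff (A : Matrix (Fin 2) (Fin 2) ℝ) (g : L2) (G : Submodule ℂ L2)
    (hN : ∀ f, f ∈ Gᗮ ↔ NullAt A g 0 f)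
    (x : Fin 2 → ℝ) (f : L2) : NullAt A g x f ↔ tf (-latVec A x) f ∈ Gᗮ := by
  rw [hN, ← nullAt_add_iff, add_zero]

lemma nullAt_add_nsmul (A : Matrix (Fin 2) (Fin 2) ℝ) (g : L2) (G : Submodule ℂ L2)
    (hN : ∀ f, f ∈ Gᗮ ↔ NullAt A g 0 f)
    (u : Fin 2 → ℝ)
    (hu : ∀ q ∈ G, tf (latVec A u) q ∈ G)
    (x : Fin 2 → ℝ) (f : L2) (hf : NullAt A g x f) (n : ℕ) :
    NullAt A g (x + (n : ℝ) • u) f := by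
  rw [nullAt_add_iff, nullAt_iff A g G hN, latVec_smul]
  exact tf_neg_mem_orthogonal (tf_nsmul_mem hu n) ((nullAt_iff A g G hN x f).1 hf)

lemma inner_meanOp_of_nullAt (A : Matrix (Fin 2) (Fin 2) ℝ) (g : L2) (G : Submodule ℂ L2)
    (hN : ∀ f, f ∈ Gᗮ ↔ NullAt A g 0 f)
    (u : Fin 2 → ℝ)
    (hu : ∀ q ∈ G, tf (latVec A u) q ∈ G)
    (hA : A.det ≠ 0)
    (hg : Summable fun μ : Fin 2 → ℤ => ‖⟪tf (adjVec A μ) g, g⟫_ℂ‖) (hb : IsBessel A g)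
    (x : Fin 2 → ℝ) (f f' : L2) (hf : NullAt A g x f) :
    ⟪f', meanOp A g u x f⟫_ℂ = 0 ∧ ⟪f, meanOp A g u x f'⟫_ℂ = 0 := by
  have h := fun n => inner_specOp_of_nullAt A hA g f f' hg hb _
    (nullAt_add_nsmul A g G hN u hu x f hf n)
  constructor
  · refine tendsto_nhds_unique (tendsto_mean_specOp A g f f' hg u x) ?_
    simp only [(h _).1, Finset.sum_const_zero, mul_zero]
    exact tendsto_const_nhds
  · refine tendsto_nhds_unique (tendsto_mean_specOp A g f' f hg u x) ?_
    simp only [(h _).2, Finset.sum_const_zero, mul_zero]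
    exact tendsto_const_nhds

lemma le_re_inner_meanOp (A : Matrix (Fin 2) (Fin 2) ℝ) (g : L2) (G : Submodule ℂ L2)
    (u : Fin 2 → ℝ)
    (hA : A.det ≠ 0)
    (hg : Summable fun μ : Fin 2 → ℤ => ‖⟪tf (adjVec A μ) g, g⟫_ℂ‖) (hb : IsBessel A g)
    (a : ℝ)
    (ha : ∀ q ∈ G, a * ‖q‖ ^ 2 ≤ ∑' k : Fin 2 → ℤ, ‖⟪tf (latVec A (castVec k)) g, q⟫_ℂ‖ ^ 2)
    (hu' : ∀ q ∈ G, tf (-latVec A u) q ∈ G)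
    (q : L2) (hq : q ∈ G) :
    a * ‖q‖ ^ 2 ≤ (⟪q, meanOp A g u 0 q⟫_ℂ).re := by
  have h := (Complex.continuous_re.tendsto _).comp (tendsto_mean_specOp A g q q hg u 0)
  refine ge_of_tendsto h ?_
  filter_upwards [eventually_gt_atTop 0] with N hN
  have h1 : ∀ n : ℕ, a * ‖q‖ ^ 2 ≤ perSpec A g q (0 + (n : ℝ) • u) := by
    intro n
    rw [perSpec_eq, zero_add, latVec_smul, ← smul_neg, ← norm_tf ((n : ℝ) • -latVec A u) q]
    exact ha _ (tf_nsmul_mem hu' n q hq)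
  simp only [Function.comp_apply, inner_specOp_self A hA g q hg hb]
  rw [← Complex.ofReal_sum, ← Complex.ofReal_natCast, ← Complex.ofReal_inv, ← Complex.ofReal_mul,
    Complex.ofReal_re, le_inv_mul_iff₀ (by positivity)]
  have := Finset.card_nsmul_le_sum (Finset.range N) _ _ fun n _ => h1 n
  simpa using this

lemma nullAt_zero_of_near (A : Matrix (Fin 2) (Fin 2) ℝ) (g : L2) (G : Submodule ℂ L2)
    (hN : ∀ f, f ∈ Gᗮ ↔ NullAt A g 0 f)
    (u : Fin 2 → ℝ)
    (hu : ∀ q ∈ G, tf (latVec A u) q ∈ G)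
    (hA : A.det ≠ 0)
    (hg : Summable fun μ : Fin 2 → ℤ => ‖⟪tf (adjVec A μ) g, g⟫_ℂ‖) (hb : IsBessel A g)
    (a : ℝ)
    (ha : ∀ q ∈ G, a * ‖q‖ ^ 2 ≤ ∑' k : Fin 2 → ℤ, ‖⟪tf (latVec A (castVec k)) g, q⟫_ℂ‖ ^ 2)
    (hu' : ∀ q ∈ G, tf (-latVec A u) q ∈ G)
    [G.HasOrthogonalProjection]
    (hirr : ∀ m : ℕ, 1 ≤ m → ∀ k, (m : ℝ) • u ≠ castVec k) (ha0 : 0 < a)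
    (x : Fin 2 → ℝ) (hx : ‖meanOp A g u 0 - meanOp A g u x‖ < a) (f : L2)
    (hf : NullAt A g x f) : f ∈ Gᗮ := by
  have hzero : ∀ (x : Fin 2 → ℝ) f, NullAt A g x f → meanOp A g u x f = 0 := fun x f hf =>
    inner_self_eq_zero.1 (inner_meanOp_of_nullAt A g G hN u hu hA hg hb x f _ hf).1
  set q := meanOp A g u 0 f with hq
  have hqG : q ∈ G := by
    rw [← Submodule.orthogonal_orthogonal G, Submodule.mem_orthogonal]
    intro r hr
    exact (inner_meanOp_of_nullAt A g G hN u hu hA hg hb 0 r f ((hN r).1 hr)).2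
  have hxq : meanOp A g u x q = 0 := by
    have := congrArg (fun T : L2 →L[ℂ] L2 => T f) (commute_meanOp A g u x 0 hirr).eq
    simp only [mul_apply_eq_comp, hzero x f hf, map_zero] at this
    exact this
  have hle := le_re_inner_meanOp A g G u hA hg hb a ha hu' q hqG
  have hle2 : (⟪q, meanOp A g u 0 q⟫_ℂ).re ≤ ‖meanOp A g u 0 - meanOp A g u x‖ * ‖q‖ ^ 2 := by
    have e : meanOp A g u 0 q = (meanOp A g u 0 - meanOp A g u x) q := by
      rw [sub_apply, hxq, sub_zero]
    rw [e]
    calc _ ≤ ‖⟪q, (meanOp A g u 0 - meanOp A g u x) q⟫_ℂ‖ := Complex.re_le_norm _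
      _ ≤ ‖q‖ * (‖meanOp A g u 0 - meanOp A g u x‖ * ‖q‖) :=
        (norm_inner_le_norm _ _).trans (by gcongr; exact ContinuousLinearMap.le_opNorm _ _)
      _ = _ := by ring
  have hq0 : q = 0 := by
    by_contra h
    have : 0 < ‖q‖ ^ 2 := by positivity
    nlinarith
  obtain ⟨p, hp, r, hr, rfl⟩ := G.exists_add_mem_mem_orthogonal f
  have hp0 : meanOp A g u 0 p = 0 := by
    have : meanOp A g u 0 (p + r) = 0 := hq0
    rwa [map_add, hzero 0 r ((hN r).1 hr), add_zero] at this
  have hle3 := le_re_inner_meanOp A g G u hA hg hb a ha hu' p hp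
  rw [hp0, inner_zero_right, Complex.zero_re] at hle3
  have : p = 0 := by
    by_contra h
    have : 0 < ‖p‖ ^ 2 := by positivity
    nlinarith
  rwa [this, zero_add]

lemma exists_latVec_eq (A : Matrix (Fin 2) (Fin 2) ℝ) (hA : A.det ≠ 0) (z : ℝ × ℝ) :
    ∃ x, latVec A x = z := by
  have hdet : A.det = A 0 0 * A 1 1 - A 0 1 * A 1 0 := Matrix.det_fin_two A
  refine ⟨![(A 1 1 * z.1 - A 0 1 * z.2) / A.det, (A 0 0 * z.2 - A 1 0 * z.1) / A.det], ?_⟩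
  ext
  · simp only [latVec, Matrix.cons_val_zero, Matrix.cons_val_one]
    field_simp
    rw [hdet]; ring
  · simp only [latVec, Matrix.cons_val_zero, Matrix.cons_val_one]
    field_simp
    rw [hdet]; ring

lemma eq_top_of_irrational_invariance (A : Matrix (Fin 2) (Fin 2) ℝ) (g : L2) (G : Submodule ℂ L2)
    (hN : ∀ f, f ∈ Gᗮ ↔ NullAt A g 0 f)
    (u : Fin 2 → ℝ)
    (hu : ∀ q ∈ G, tf (latVec A u) q ∈ G)
    (hA : A.det ≠ 0)
    (hg : Summable fun μ : Fin 2 → ℤ => ‖⟪tf (adjVec A μ) g, g⟫_ℂ‖) (hb : IsBessel A g)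
    (a : ℝ)
    (ha : ∀ q ∈ G, a * ‖q‖ ^ 2 ≤ ∑' k : Fin 2 → ℤ, ‖⟪tf (latVec A (castVec k)) g, q⟫_ℂ‖ ^ 2)
    (hu' : ∀ q ∈ G, tf (-latVec A u) q ∈ G)
    [G.HasOrthogonalProjection]
    (hirr : ∀ m : ℕ, 1 ≤ m → ∀ k, (m : ℝ) • u ≠ castVec k) (ha0 : 0 < a)
    (hg0 : g ≠ 0) : G = ⊤ := by
  have hcont := (continuous_meanOp A g hg u).tendsto 0
  rw [Metric.tendsto_nhds_nhds] at hcont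
  obtain ⟨δ, hδ, hδ'⟩ := hcont a ha0
  have hsmall : ∀ x : Fin 2 → ℝ, ‖x‖ < δ → ∀ f ∈ Gᗮ, tf (latVec A x) f ∈ Gᗮ := by
    intro x hx f hf
    refine nullAt_zero_of_near A g G hN u hu hA hg hb a ha hu' hirr ha0 x ?_ _ ?_
    · have := hδ' (x := x) (by simpa using hx)
      rwa [dist_comm, dist_eq_norm] at this
    · rw [nullAt_iff A g G hN, tf_neg_tf]
      exact Submodule.smul_mem _ _ hf
  have hall : ∀ x : Fin 2 → ℝ, ∀ f ∈ Gᗮ, tf (latVec A x) f ∈ Gᗮ := by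
    intro x
    obtain ⟨n, hn⟩ := exists_nat_gt (‖x‖ / δ)
    have hn0 : (0 : ℝ) < n := lt_of_le_of_lt (by positivity) hn
    have h1 : ‖(n : ℝ)⁻¹ • x‖ < δ := by
      rw [norm_smul, norm_inv, Real.norm_natCast, inv_mul_lt_iff₀ hn0]
      rwa [div_lt_iff₀ hδ] at hn
    have h2 := tf_nsmul_mem (hsmall _ h1) n
    rwa [← latVec_smul, smul_smul, mul_inv_cancel₀ hn0.ne', one_smul] at h2
  rw [← Submodule.orthogonal_eq_bot_iff, Submodule.eq_bot_iff]
  intro f hf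
  have hV : ∀ z, ⟪tf z g, f⟫_ℂ = 0 := by
    intro z
    obtain ⟨x, hx⟩ := exists_latVec_eq A hA (-z)
    have h1 := (hN _).1 (hall x f hf) 0
    rw [inner_tf_left, ← hx]
    have h0 : latVec A (0 + castVec 0) = 0 := by simp [latVec, castVec]
    rw [h0, tf_zero] at h1
    rw [h1, mul_zero]
  have h := lintegral_inner_tf_sq f g
  simp only [hV, enorm_zero, ne_eq, OfNat.ofNat_ne_zero, not_false_eq_true, zero_pow,
    lintegral_zero] at h
  have h2 : ‖f‖ ^ 2 * ‖g‖ ^ 2 ≤ 0 := ENNReal.ofReal_eq_zero.1 h.symm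
  by_contra hf0
  have : 0 < ‖f‖ ^ 2 * ‖g‖ ^ 2 := by positivity
  exact absurd this h2.not_gt

lemma torusMk_add (x y : Fin 2 → ℝ) : torusMk (x + y) = torusMk x + torusMk y := by
  ext i; simp [torusMk]

lemma torusMk_neg (x : Fin 2 → ℝ) : torusMk (-x) = -torusMk x := by
  ext i; simp [torusMk]

lemma torusMk_nsmul (n : ℕ) (x : Fin 2 → ℝ) : torusMk (n • x) = n • torusMk x := by
  ext i; simp [torusMk]

lemma preimage_image_torusMk (J : AddSubmonoid (Fin 2 → ℝ)) (hJ : ∀ k, castVec k ∈ J) :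
    torusMk ⁻¹' (torusMk '' (J : Set (Fin 2 → ℝ))) = J := by
  refine Set.Subset.antisymm ?_ (Set.subset_preimage_image _ _)
  rintro x ⟨y, hy, hyx⟩
  obtain ⟨k, rfl⟩ := (torusMk_eq_iff y x).1 hyx
  exact J.add_mem hy (hJ k)

lemma isClosed_image_torusMk (J : AddSubmonoid (Fin 2 → ℝ)) (hJ : ∀ k, castVec k ∈ J)
    (hc : IsClosed (J : Set (Fin 2 → ℝ))) : IsClosed (torusMk '' (J : Set (Fin 2 → ℝ))) := by
  rw [← isOpenQuotientMap_torusMk.isQuotientMap.isClosed_preimage, preimage_image_torusMk J hJ]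
  exact hc

/-- A closed submonoid of `ℝ²` containing `ℤ²` is a group. -/
lemma neg_mem_of_isClosed (J : AddSubmonoid (Fin 2 → ℝ)) (hJ : ∀ k, castVec k ∈ J)
    (hc : IsClosed (J : Set (Fin 2 → ℝ))) {x : Fin 2 → ℝ} (hx : x ∈ J) : -x ∈ J := by
  have h := mapClusterPt_self_zsmul_atTop_nsmul (torusMk x) (-1)
  have hmem : torusMk (-x) ∈ torusMk '' (J : Set (Fin 2 → ℝ)) := by
    rw [torusMk_neg, ← neg_one_zsmul]
    refine (isClosed_image_torusMk J hJ hc).mem_of_mapClusterPt h (Eventually.of_forall fun n => ?_)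
    exact ⟨n • x, J.nsmul_mem hx n, torusMk_nsmul n x⟩
  have h2 : -x ∈ torusMk ⁻¹' (torusMk '' (J : Set (Fin 2 → ℝ))) := hmem
  rwa [preimage_image_torusMk J hJ] at h2

/-- A closed submonoid of `ℝ²` containing `ℤ²` and all of whose elements are rational lies in
`(1/m)ℤ²` for some `m`. -/
lemma exists_denominator (J : AddSubmonoid (Fin 2 → ℝ)) (hJ : ∀ k, castVec k ∈ J)
    (hc : IsClosed (J : Set (Fin 2 → ℝ)))
    (hrat : ∀ u ∈ J, ∃ m : ℕ, 1 ≤ m ∧ ∃ k, (m : ℝ) • u = castVec k) :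
    ∃ m : ℕ, 1 ≤ m ∧ ∀ u ∈ J, ∃ k, (m : ℝ) • u = castVec k := by
  let H : AddSubgroup (UnitAddTorus (Fin 2)) :=
    { carrier := torusMk '' (J : Set (Fin 2 → ℝ))
      zero_mem' := ⟨0, J.zero_mem, by ext i; simp [torusMk]⟩
      add_mem' := by
        rintro _ _ ⟨x, hx, rfl⟩ ⟨y, hy, rfl⟩
        exact ⟨x + y, J.add_mem hx hy, torusMk_add x y⟩
      neg_mem' := by
        rintro _ ⟨x, hx, rfl⟩
        exact ⟨-x, neg_mem_of_isClosed J hJ hc hx, torusMk_neg x⟩ }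
  have hHc : IsClosed (H : Set (UnitAddTorus (Fin 2))) := isClosed_image_torusMk J hJ hc
  have hcount : (H : Set (UnitAddTorus (Fin 2))).Countable := by
    refine (Set.countable_range fun p : ℕ × (Fin 2 → ℤ) =>
      torusMk ((p.1 : ℝ)⁻¹ • castVec p.2)).mono ?_
    rintro _ ⟨u, hu, rfl⟩
    obtain ⟨m, hm, k, hk⟩ := hrat u hu
    have hm0 : (m : ℝ) ≠ 0 := by positivity
    exact ⟨(m, k), by simp only [← hk, smul_smul, inv_mul_cancel₀ hm0, one_smul]⟩
  have : CompactSpace H := isCompact_iff_compactSpace.1 hHc.isCompact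
  have : Countable H := hcount.to_subtype
  obtain ⟨t, ht⟩ := nonempty_interior_of_iUnion_of_closed (X := H) (f := fun t : H => {t})
    (fun t => isClosed_singleton) (Set.iUnion_of_singleton H)
  have hopen : IsOpen ({t} : Set H) := by
    have : interior ({t} : Set H) = {t} :=
      (Set.subset_singleton_iff_eq.1 interior_subset).resolve_left ht.ne_empty
    exact this ▸ isOpen_interior
  have hzero : IsOpen ({0} : Set H) := by
    have := hopen.preimage (continuous_const_add t)
    simpa [Set.preimage, Set.ofPred_eq_eq_singleton] using this
  have := discreteTopology_of_isOpen_singleton_zero hzero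
  have : Finite H := finite_of_compact_of_discrete
  refine ⟨Nat.card H, Nat.card_pos, fun u hu => ?_⟩
  have h1 : Nat.card H • (⟨torusMk u, u, hu, rfl⟩ : H) = 0 := card_nsmul_eq_zero'
  have h2 : torusMk 0 = torusMk (Nat.card H • u) := by
    rw [torusMk_nsmul]
    exact (by ext i; simp [torusMk] : torusMk 0 = 0).trans (congrArg Subtype.val h1).symm
  obtain ⟨k, hk⟩ := (torusMk_eq_iff _ _).1 h2
  exact ⟨k, by rw [Nat.cast_smul_eq_nsmul, hk, zero_add]⟩

lemma latVec_injective (A : Matrix (Fin 2) (Fin 2) ℝ) (hA : A.det ≠ 0) :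
    Function.Injective (latVec A) := by
  intro x y h
  rw [Matrix.det_fin_two] at hA
  simp only [latVec, Prod.mk.injEq] at h
  obtain ⟨h0, h1⟩ := h
  ext i
  apply mul_left_cancel₀ hA
  fin_cases i
  · simp only [Fin.zero_eta]; linear_combination A 1 1 * h0 - A 0 1 * h1
  · simp only [Fin.mk_one]; linear_combination A 0 0 * h1 - A 1 0 * h0

lemma castVec_injective : Function.Injective castVec := fun k l h => by
  ext i; exact Int.cast_injective (α := ℝ) (congrFun h i)

/-- The lattice `Aℤ²`. -/
def lat (A : Matrix (Fin 2) (Fin 2) ℝ) : Set (ℝ × ℝ) := Set.range fun k => latVec A (castVec k)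

lemma IsLattice.exists_eq_lat {Λ : Set (ℝ × ℝ)} (h : IsLattice Λ) :
    ∃ A : Matrix (Fin 2) (Fin 2) ℝ, A.det ≠ 0 ∧ Λ = lat A := by
  obtain ⟨A, hA, rfl⟩ := h
  refine ⟨A, hA.ne_zero, ?_⟩
  ext p
  constructor
  · rintro ⟨k, l, rfl⟩
    exact ⟨![k, l], by simp [latVec, castVec]⟩
  · rintro ⟨k, rfl⟩
    exact ⟨k 0, k 1, rfl⟩

lemma tsum_lat (A : Matrix (Fin 2) (Fin 2) ℝ) (hA : A.det ≠ 0) (F : ℝ × ℝ → ℝ) :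
    ∑' lam : lat A, F lam = ∑' k, F (latVec A (castVec k)) :=
  tsum_range F ((latVec_injective A hA).comp castVec_injective)

/-- The closed linear span of the Gabor system `(g, Aℤ²)` as a submodule. -/
def gaborSub (A : Matrix (Fin 2) (Fin 2) ℝ) (g : L2) : Submodule ℂ L2 :=
  (Submodule.span ℂ ((fun z => tf z g) '' lat A)).topologicalClosure

lemma coe_gaborSub (A : Matrix (Fin 2) (Fin 2) ℝ) (g : L2) :
    (gaborSub A g : Set L2) = gaborSpan g (lat A) :=
  Submodule.topologicalClosure_coe _

lemma isClosed_gaborSub (A : Matrix (Fin 2) (Fin 2) ℝ) (g : L2) :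
    IsClosed (gaborSub A g : Set L2) :=
  Submodule.isClosed_topologicalClosure _

instance (A : Matrix (Fin 2) (Fin 2) ℝ) (g : L2) : (gaborSub A g).HasOrthogonalProjection :=
  haveI : CompleteSpace (gaborSub A g) := (isClosed_gaborSub A g).completeSpace_coe
  inferInstance

lemma tf_lat_mem_gaborSub (A : Matrix (Fin 2) (Fin 2) ℝ) (g : L2) (k : Fin 2 → ℤ) :
    tf (latVec A (castVec k)) g ∈ gaborSub A g :=
  Submodule.le_topologicalClosure _ (Submodule.subset_span ⟨_, ⟨k, rfl⟩, rfl⟩)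

lemma mem_orthogonal_gaborSub (A : Matrix (Fin 2) (Fin 2) ℝ) (g f : L2) :
    f ∈ (gaborSub A g)ᗮ ↔ NullAt A g 0 f := by
  rw [gaborSub, Submodule.orthogonal_closure, Submodule.mem_orthogonal]
  constructor
  · intro h k
    rw [zero_add]
    exact h _ (Submodule.subset_span ⟨_, ⟨k, rfl⟩, rfl⟩)
  · intro h v hv
    induction hv using Submodule.span_induction with
    | mem v hv =>
      obtain ⟨_, ⟨k, rfl⟩, rfl⟩ := hv
      simpa using h k
    | zero => exact inner_zero_left _
    | add v w _ _ hv hw => rw [inner_add_left, hv, hw, add_zero]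
    | smul c v _ hv => rw [inner_smul_left, hv, mul_zero]

/-- The Gabor space is invariant under the shifts of its lattice. -/
lemma tf_lat_mem (A : Matrix (Fin 2) (Fin 2) ℝ) (g : L2) (k : Fin 2 → ℤ) :
    ∀ q ∈ gaborSub A g, tf (latVec A (castVec k)) q ∈ gaborSub A g := by
  let T := (tfI (latVec A (castVec k))).toContinuousLinearMap
  have h : gaborSub A g ≤ (gaborSub A g).comap (T : L2 →ₗ[ℂ] L2) := by
    refine Submodule.topologicalClosure_minimal _ (Submodule.span_le.2 ?_)
      ((isClosed_gaborSub A g).preimage T.continuous)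
    rintro _ ⟨_, ⟨l, rfl⟩, rfl⟩
    change tf _ (tf _ g) ∈ gaborSub A g
    rw [tf_tf, ← latVec_add, ← castVec_add]
    exact Submodule.smul_mem _ _ (tf_lat_mem_gaborSub A g (k + l))
  exact fun q hq => h hq

/-- The parameters `x` such that the shift by `A x` leaves the Gabor space invariant. -/
def stabMonoid (A : Matrix (Fin 2) (Fin 2) ℝ) (g : L2) : AddSubmonoid (Fin 2 → ℝ) where
  carrier := {x | ∀ q ∈ gaborSub A g, tf (latVec A x) q ∈ gaborSub A g}
  zero_mem' := by
    have := tf_lat_mem A g 0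
    have h0 : castVec 0 = 0 := by ext i; simp [castVec]
    rwa [h0] at this
  add_mem' := by
    intro x y hx hy
    simp only [Set.mem_ofPred_eq, latVec_add]
    exact tf_add_mem hx hy

lemma isClosed_stabMonoid (A : Matrix (Fin 2) (Fin 2) ℝ) (g : L2) :
    IsClosed (stabMonoid A g : Set (Fin 2 → ℝ)) := by
  have : (stabMonoid A g : Set (Fin 2 → ℝ)) =
      ⋂ q ∈ gaborSub A g, (fun x => tf (latVec A x) q) ⁻¹' (gaborSub A g : Set L2) := by
    ext x; simp [stabMonoid]
  rw [this]
  exact isClosed_biInter fun q _ =>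
    (isClosed_gaborSub A g).preimage ((continuous_tf q).comp (continuous_latVec A))

lemma latVec_mem_stab (A : Matrix (Fin 2) (Fin 2) ℝ) (g : L2) (x : Fin 2 → ℝ) :
    latVec A x ∈ stab (gaborSpan g (lat A)) ↔ x ∈ stabMonoid A g := by
  rw [← coe_gaborSub]; rfl

/-- A frame sequence satisfies the upper bound on all of `L²(ℝ)`. -/
lemma IsFrameSeq.isBessel {A : Matrix (Fin 2) (Fin 2) ℝ} (hA : A.det ≠ 0) {g : L2}
    (h : IsFrameSeq g (lat A)) : IsBessel A g := by
  obtain ⟨a, B, ha, hB, h⟩ := h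
  refine ⟨B, fun f => ?_⟩
  obtain ⟨p, hp, r, hr, rfl⟩ := (gaborSub A g).exists_add_mem_mem_orthogonal f
  have hin : ∀ k : Fin 2 → ℤ, ⟪tf (latVec A (castVec k)) g, p + r⟫_ℂ =
      ⟪tf (latVec A (castVec k)) g, p⟫_ℂ := fun k => by
    rw [inner_add_right, Submodule.inner_right_of_mem_orthogonal (tf_lat_mem_gaborSub A g k) hr,
      add_zero]
  simp only [hin]
  have hp' : p ∈ gaborSpan g (lat A) := coe_gaborSub A g ▸ hp
  obtain ⟨hlow, hup⟩ := h p hp'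
  rw [tsum_lat A hA fun z => ‖⟪tf z g, p⟫_ℂ‖ ^ 2] at hlow hup
  have hnorm : ‖p‖ ^ 2 ≤ ‖p + r‖ ^ 2 := by
    have := norm_add_sq_eq_norm_sq_add_norm_sq_of_inner_eq_zero p r
      (Submodule.inner_right_of_mem_orthogonal (𝕜 := ℂ) hp hr)
    nlinarith [sq_nonneg ‖r‖]
  refine ⟨?_, hup.trans (by gcongr)⟩
  by_cases hp0 : p = 0
  · simp [hp0]
  · by_contra hns
    rw [tsum_eq_zero_of_not_summable hns] at hlow
    have : 0 < ‖p‖ := norm_pos_iff.2 hp0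
    exact absurd hlow (not_le.2 (by positivity))

lemma stab_univ : stab Set.univ = Set.univ := by simp [stab]

lemma inv_smul_lat_ne_univ (A : Matrix (Fin 2) (Fin 2) ℝ) (m : ℕ) :
    ¬ (Set.univ : Set (ℝ × ℝ)) ⊆ {p | ∃ q ∈ lat A, p = (m : ℝ)⁻¹ • q} := by
  intro h
  have hc : (Set.univ : Set (ℝ × ℝ)).Countable := by
    refine (Set.countable_range fun k => (m : ℝ)⁻¹ • latVec A (castVec k)).mono fun p _ => ?_
    obtain ⟨_, ⟨k, rfl⟩, rfl⟩ := h (Set.mem_univ p)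
    exact ⟨k, rfl⟩
  have : (Set.univ : Set ℝ).Countable := by
    simpa using hc.image Prod.fst
  exact Cardinal.not_countable_real this

/-- exactly one of (a) `𝔍(𝒢) ⊆ (1/m)Λ` for some `m ≥ 1`,
(b) `𝒢 = L²(ℝ)` holds. -/
theorem statement_6 (g : L2) (hg : InS0 g) (hg0 : g ≠ 0)
    (Λ : Set (ℝ × ℝ)) (hΛ : IsLattice Λ) (hframe : IsFrameSeq g Λ) :
    Xor' (∃ m : ℕ, 1 ≤ m ∧
        stab (gaborSpan g Λ) ⊆ {p : ℝ × ℝ | ∃ q ∈ Λ, p = ((m : ℝ))⁻¹ • q})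
      (gaborSpan g Λ = Set.univ) := by
  obtain ⟨A, hA, rfl⟩ := hΛ.exists_eq_lat
  have hnot : ∀ m : ℕ, stab (gaborSpan g (lat A)) ⊆ {p | ∃ q ∈ lat A, p = (m : ℝ)⁻¹ • q} →
      gaborSpan g (lat A) ≠ Set.univ := by
    intro m hm hu
    rw [hu, stab_univ] at hm
    exact inv_smul_lat_ne_univ A m hm
  have hint := fun k => tf_lat_mem A g k
  by_cases hrat : ∀ u ∈ stabMonoid A g, ∃ m : ℕ, 1 ≤ m ∧ ∃ k, (m : ℝ) • u = castVec k
  · obtain ⟨m, hm, hden⟩ := exists_denominator (stabMonoid A g) hint (isClosed_stabMonoid A g) hrat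
    have hsub : stab (gaborSpan g (lat A)) ⊆ {p | ∃ q ∈ lat A, p = (m : ℝ)⁻¹ • q} := by
      intro z hz
      obtain ⟨x, rfl⟩ := exists_latVec_eq A hA z
      obtain ⟨k, hk⟩ := hden x ((latVec_mem_stab A g x).1 hz)
      have hm0 : (m : ℝ) ≠ 0 := by positivity
      exact ⟨_, ⟨k, rfl⟩, by simp only [← hk, latVec_smul, inv_smul_smul₀ hm0]⟩
    exact Or.inl ⟨⟨m, hm, hsub⟩, hnot m hsub⟩
  · push Not at hrat
    obtain ⟨u, hu, hirr⟩ := hrat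
    have hneg : ∀ q ∈ gaborSub A g, tf (-latVec A u) q ∈ gaborSub A g := by
      have h := neg_mem_of_isClosed (stabMonoid A g) hint (isClosed_stabMonoid A g) hu
      have hl : latVec A (-u) = -latVec A u := by
        simpa using latVec_smul A (-1) u
      exact hl ▸ h
    have hb := hframe.isBessel hA
    obtain ⟨a, B, ha, -, hfr⟩ := hframe
    have htop : gaborSub A g = ⊤ :=
      eq_top_of_irrational_invariance A g _ (mem_orthogonal_gaborSub A g) u hu hA
        (summable_norm_inner_adjVec g hg A hA) hb a
        (fun q hq => by
          rw [← tsum_lat A hA fun z => ‖⟪tf z g, q⟫_ℂ‖ ^ 2]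
          exact (hfr q (coe_gaborSub A g ▸ hq)).1)
        hneg hirr ha hg0
    have huniv : gaborSpan g (lat A) = Set.univ := by
      rw [← coe_gaborSub, htop, Submodule.top_coe]
    exact Or.inr ⟨huniv, fun ⟨m, _, hm⟩ => hnot m hm huniv⟩

end
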